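/- arXiv:2204.06460 — 3 statements merged into one kernel-verified Lean document; each statement's English description precedes it below -/
import Mathlib

section
/- Let G be a (P_5, paw)-free graph, and let S and T be disjoint stable sets of G such that every vertex of T has a neighbour in S (T may be empty). Then G admits a proper (ω(G)+1)-coloring in which S is monochromatic and T is monochromatic. -/
open SimpleGraph

/-- The paw: a triangle 0,1,2 plus vertex 3 adjacent only to 0. -/
def pawGraph : SimpleGraph (Fin 4) :=
  SimpleGraph.fromEdgeSet {s(0,1), s(0,2), s(1,2), s(0,3)}

/-- The HVN: a K₄ on 0,1,2,3 plus vertex 4 adjacent to exactly 0 and 1. -/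
def hvnGraph : SimpleGraph (Fin 5) :=
  SimpleGraph.fromEdgeSet {s(0,1), s(0,2), s(0,3), s(1,2), s(1,3), s(2,3), s(4,0), s(4,1)}

/-- The T-5-wheel: 5-cycle 0-1-2-3-4-0 plus vertex 5 adjacent to the three consecutive
vertices 4, 0, 1. -/
def t5WheelGraph : SimpleGraph (Fin 6) :=
  SimpleGraph.fromEdgeSet {s(0,1), s(1,2), s(2,3), s(3,4), s(4,0), s(5,4), s(5,0), s(5,1)}

/-- The Y-5-wheel: 5-cycle 0-1-2-3-4-0 plus vertex 5 adjacent to 0, 1, 3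
(three non-consecutive vertices). -/
def y5WheelGraph : SimpleGraph (Fin 6) :=
  SimpleGraph.fromEdgeSet {s(0,1), s(1,2), s(2,3), s(3,4), s(4,0), s(5,0), s(5,1), s(5,3)}

/-- `G` contains an induced copy of `H`: an injection preserving and reflecting adjacency. -/
def ContainsInduced {V W : Type*} (G : SimpleGraph V) (H : SimpleGraph W) : Prop :=
  ∃ f : W ↪ V, ∀ a b : W, H.Adj a b ↔ G.Adj (f a) (f b)

/-- `G` is `H`-free: no induced copy of `H`. -/
def InducedFree {V W : Type*} (G : SimpleGraph V) (H : SimpleGraph W) : Prop :=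
  ¬ ContainsInduced G H

/-- `v` lists the vertices of an induced (chordless) 5-cycle of `G`, in order. -/
def IsInducedC5 {V : Type*} (G : SimpleGraph V) (v : ZMod 5 → V) : Prop :=
  Function.Injective v ∧ ∀ i j : ZMod 5, G.Adj (v i) (v j) ↔ (j = i + 1 ∨ j = i - 1)

/-- Every stable subset of `A` extends to a stable subset that dominates `A`. -/
lemma exists_max_stable {V : Type*} [Finite V] (G : SimpleGraph V) (A S : Set V)
    (hSA : S ⊆ A) (hS : ∀ u ∈ S, ∀ w ∈ S, ¬ G.Adj u w) :
    ∃ X : Set V, S ⊆ X ∧ X ⊆ A ∧ (∀ u ∈ X, ∀ w ∈ X, ¬ G.Adj u w) ∧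
      ∀ v ∈ A, v ∉ X → ∃ x ∈ X, G.Adj v x := by
  obtain ⟨X, hSX, hX⟩ := Finite.exists_le_maximal
    (p := fun X : Set V => X ⊆ A ∧ ∀ u ∈ X, ∀ w ∈ X, ¬ G.Adj u w) ⟨hSA, hS⟩
  refine ⟨X, hSX, hX.prop.1, hX.prop.2, fun v hvA hvX => ?_⟩
  by_contra! hcon
  apply hvX
  have hle : insert v X ⊆ X := by
    refine hX.le_of_ge ⟨Set.insert_subset hvA hX.prop.1, ?_⟩ (Set.subset_insert v X)
    intro u hu w hw
    rcases hu with rfl | hu <;> rcases hw with rfl | hw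
    · exact G.irrefl
    · exact hcon _ hw
    · exact fun h => hcon _ hu h.symm
    · exact hX.prop.2 _ hu _ hw
  exact hle (Set.mem_insert v X)

lemma p5_form {V : Type*} (G : SimpleGraph V) (hP5 : InducedFree G (pathGraph 5))
    (a b c d e : V) (hab : G.Adj a b) (hbc : G.Adj b c) (hcd : G.Adj c d) (hde : G.Adj d e)
    (hac : ¬ G.Adj a c) (had : ¬ G.Adj a d) (hae : ¬ G.Adj a e)
    (hbd : ¬ G.Adj b d) (hbe : ¬ G.Adj b e) (hce : ¬ G.Adj c e) : False := by
  apply hP5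
  have n1 := hab.ne
  have n2 := hbc.ne
  have n3 := hcd.ne
  have n4 := hde.ne
  have n5 : a ≠ c := by rintro rfl; exact had hcd
  have n6 : a ≠ d := by rintro rfl; exact hae hde
  have n7 : a ≠ e := by rintro rfl; exact had hde.symm
  have n8 : b ≠ d := by rintro rfl; exact hbe hde
  have n9 : b ≠ e := by rintro rfl; exact hae hab
  have n10 : c ≠ e := by rintro rfl; exact hbe hbc
  refine ⟨⟨![a, b, c, d, e], ?_⟩, ?_⟩
  · intro i j hij
    fin_cases i <;> fin_cases j <;> simp_all
  · intro i j
    change _ ↔ G.Adj (![a, b, c, d, e] i) (![a, b, c, d, e] j)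
    clear hP5
    fin_cases i <;> fin_cases j <;> simp_all [pathGraph_adj, G.adj_comm]

lemma paw_form {V : Type*} (G : SimpleGraph V) (hpaw : InducedFree G pawGraph)
    (x y z w : V) (hxy : G.Adj x y) (hxz : G.Adj x z) (hyz : G.Adj y z) (hxw : G.Adj x w) :
    G.Adj w y ∨ G.Adj w z := by
  by_contra! hcon
  obtain ⟨h1, h2⟩ := hcon
  apply hpaw
  have n1 := hxy.ne
  have n2 := hxz.ne
  have n3 := hyz.ne
  have n4 := hxw.ne
  have n5 : y ≠ w := by rintro rfl; exact h2 hyz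
  have n6 : z ≠ w := by rintro rfl; exact h1 hyz.symm
  refine ⟨⟨![x, y, z, w], ?_⟩, ?_⟩
  · intro i j hij
    fin_cases i <;> fin_cases j <;> simp_all
  · intro i j
    change _ ↔ G.Adj (![x, y, z, w] i) (![x, y, z, w] j)
    clear hpaw
    fin_cases i <;> fin_cases j <;> simp_all [pawGraph, G.adj_comm]

/-- A set of vertices is closed along edges and contains `r`: it contains everything reachable. -/
lemma reach_induct {V : Type*} (G : SimpleGraph V) (P : V → Prop) (r w : V)
    (h : G.Reachable r w) (h0 : P r) (hs : ∀ x y, G.Adj x y → P x → P y) : P w := by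
  rw [SimpleGraph.reachable_iff_reflTransGen] at h
  induction h with
  | refl => exact h0
  | tail _ hxy ih => exact hs _ _ hxy ih

/-- Reachable edges in a triangle-free P5-free graph are joined by an edge. -/
lemma no_two_edges {V : Type*} (G : SimpleGraph V) (hP5 : InducedFree G (pathGraph 5))
    (a b c d : V)
    (htri : ∀ x y z, G.Reachable a x → G.Adj x y → G.Adj y z → G.Adj x z → False)
    (hab : G.Adj a b) (hcd : G.Adj c d) (hr : G.Reachable a c)
    (hac : ¬ G.Adj a c) (had : ¬ G.Adj a d) (hbc : ¬ G.Adj b c) (hbd : ¬ G.Adj b d) : False := by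
  have htri1 : ∀ x, G.Adj x a → G.Adj x b → False := fun x h1 h2 =>
    htri a b x (Reachable.refl a) hab h2.symm h1.symm
  have key : G.Adj c a ∨ G.Adj c b ∨ ∃ x, G.Adj c x ∧ (G.Adj x a ∨ G.Adj x b) := by
    refine reach_induct G (fun c => G.Adj c a ∨ G.Adj c b ∨
      ∃ x, G.Adj c x ∧ (G.Adj x a ∨ G.Adj x b)) a c hr (Or.inr (Or.inl hab)) ?_
    intro w w' hww hw
    by_cases ha : G.Adj w a
    · exact Or.inr (Or.inr ⟨w, hww.symm, Or.inl ha⟩)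
    by_cases hb : G.Adj w b
    · exact Or.inr (Or.inr ⟨w, hww.symm, Or.inr hb⟩)
    obtain ⟨x, hwx, hx⟩ := (hw.resolve_left ha).resolve_left hb
    by_contra! hcon
    obtain ⟨c1, c2, c3⟩ := hcon
    have c4 : ¬ G.Adj x w' := fun h => by
      have := c3 x h.symm
      tauto
    rcases hx with hx | hx
    · exact p5_form G hP5 b a x w w' hab.symm hx.symm hwx.symm hww
        (fun h => htri1 x hx h.symm) (fun h => hb h.symm) (fun h => c2 h.symm)
        (fun h => ha h.symm) (fun h => c1 h.symm) c4
    · exact p5_form G hP5 a b x w w' hab hx.symm hwx.symm hww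
        (fun h => htri1 x h.symm hx) (fun h => ha h.symm) (fun h => c1 h.symm)
        (fun h => hb h.symm) (fun h => c2 h.symm) c4
  obtain ⟨x, hcx, hx⟩ := (key.resolve_left fun h => hac h.symm).resolve_left fun h => hbc h.symm
  have hxd : ¬ G.Adj x d := fun h => htri c x d hr hcx h hcd
  rcases hx with hx | hx
  · exact p5_form G hP5 b a x c d hab.symm hx.symm hcx.symm hcd
      (fun h => htri1 x hx h.symm) hbc hbd hac had hxd
  · exact p5_form G hP5 a b x c d hab hx.symm hcx.symm hcd
      (fun h => htri1 x h.symm hx) hac had hbc hbd hxd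

/-- In a triangle-free P5-free component, what remains outside two greedily chosen
maximal stable sets is stable. -/
lemma rest_stable {V : Type*} (G : SimpleGraph V) (C X Y : Set V)
    (hXC : X ⊆ C) (hYC : Y ⊆ C)
    (htri : ∀ x ∈ C, ∀ y z, G.Adj x y → G.Adj y z → G.Adj x z → False)
    (h2 : ∀ a ∈ C, ∀ c ∈ C, ∀ b d, G.Adj a b → G.Adj c d → ¬ G.Adj a c → ¬ G.Adj a d →
      ¬ G.Adj b c → ¬ G.Adj b d → False)
    (hX : ∀ u ∈ X, ∀ w ∈ X, ¬ G.Adj u w) (hY : ∀ u ∈ Y, ∀ w ∈ Y, ¬ G.Adj u w)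
    (hXd : ∀ v ∈ C, v ∉ X → ∃ x ∈ X, G.Adj v x)
    (hYd : ∀ v ∈ C, v ∉ X → v ∉ Y → ∃ y ∈ Y, G.Adj v y)
    (hXY : ∀ v ∈ Y, v ∉ X)
    (a b : V) (ha : a ∈ C) (hb : b ∈ C) (haX : a ∉ X) (haY : a ∉ Y) (hbX : b ∉ X) (hbY : b ∉ Y)
    (hab : G.Adj a b) : False := by
  have tri : ∀ x y z, x ∈ C → G.Adj x y → G.Adj x z → ¬ G.Adj y z :=
    fun x y z hx h1 h3 h2 => htri x hx y z h1 h2 h3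
  obtain ⟨t, htY, hat⟩ := hYd a ha haX haY
  obtain ⟨t', htY', hbt⟩ := hYd b hb hbX hbY
  have htC := hYC htY
  have htC' := hYC htY'
  have htb : ¬ G.Adj t b := tri a t b ha hat hab
  have hta : ¬ G.Adj t' a := tri b t' a hb hbt hab.symm
  have htt : ¬ G.Adj t t' := hY t htY t' htY'
  have hcommon : ∃ s ∈ X, G.Adj t s ∧ G.Adj t' s := by
    obtain ⟨s, hs, hts⟩ := hXd t htC (hXY t htY)
    obtain ⟨s', hs', hts'⟩ := hXd t' htC' (hXY t' htY')
    by_contra! hcon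
    exact h2 t htC t' htC' s s' hts hts' htt (fun h => hcon s' hs' h hts')
      (fun h => hcon s hs hts h.symm) (hX s hs s' hs')
  obtain ⟨s, hs, hts, hts'⟩ := hcommon
  have hsC := hXC hs
  obtain ⟨p, hp, hap⟩ := hXd a ha haX
  obtain ⟨q, hq, hbq⟩ := hXd b hb hbX
  have hsa : ¬ G.Adj s a := tri t s a htC hts hat.symm
  have hsb : ¬ G.Adj s b := tri t' s b htC' hts' hbt.symm
  have hpt' : G.Adj t' p := by
    by_contra hcon
    exact h2 s hsC a ha t' p hts'.symm hap hsa (hX s hs p hp) hta hcon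
  have hqt : G.Adj t q := by
    by_contra hcon
    exact h2 s hsC b hb t q hts.symm hbq hsb (hX s hs q hq) htb hcon
  have hpt : ¬ G.Adj p t := tri a p t ha hap hat
  have hqt' : ¬ G.Adj q t' := tri b q t' hb hbq hbt
  exact h2 t htC t' htC' q p hqt hpt' htt (fun h => hpt h.symm) hqt' (hX q hq p hp)

/-- In a component where every vertex lies in a triangle, every edge dominates. -/
lemma edge_dominates {V : Type*} (G : SimpleGraph V) (hpaw : InducedFree G pawGraph)
    (u v w : V) (htri : ∀ x, G.Reachable u x → ∃ y z, G.Adj x y ∧ G.Adj x z ∧ G.Adj y z)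
    (huv : G.Adj u v) (hr : G.Reachable u w) : G.Adj w u ∨ G.Adj w v := by
  have paw := paw_form G hpaw
  have etri : ∀ x y, G.Reachable u x → G.Adj x y → ∃ z, G.Adj x z ∧ G.Adj y z := by
    intro x y hx hxy
    obtain ⟨p, q, hp, hq, hpq⟩ := htri x hx
    rcases paw x p q y hp hq hpq hxy with h | h
    · exact ⟨p, hp, h⟩
    · exact ⟨q, hq, h⟩
  have aux : ∀ u' v' x y, G.Reachable u u' → G.Adj u' v' → G.Adj x y → G.Adj x u' →
      G.Adj y u' ∨ G.Adj y v' := by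
    intro u' v' x y hu' huv' hxy hxu
    by_contra! hcon
    obtain ⟨c1, c2⟩ := hcon
    by_cases hxv : G.Adj x v'
    · rcases paw x u' v' y hxu hxv huv' hxy with h | h
      · exact c1 h
      · exact c2 h
    obtain ⟨z, hz, hxz⟩ := etri u' x hu' hxu.symm
    have hvz : G.Adj v' z :=
      (paw u' x z v' hxu.symm hz hxz huv').resolve_left fun h => hxv h.symm
    have hyz : G.Adj y z := (paw x u' z y hxu hxz hz hxy).resolve_left c1
    rcases paw z u' v' y hz.symm hvz.symm huv' hyz.symm with h | h
    · exact c1 h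
    · exact c2 h
  refine reach_induct G (fun w => G.Adj w u ∨ G.Adj w v) u w hr (Or.inr huv) ?_
  intro x y hxy hx
  rcases hx with hx | hx
  · exact aux u v x y (Reachable.refl u) huv hxy hx
  · exact (aux v u x y huv.reachable huv.symm hxy hx).symm

/-- A set on which nonadjacency is transitive is coloured, part by part, with `ω` colours. -/
lemma multipartite_color {V : Type*} [Fintype V] (G : SimpleGraph V) (C : Set V)
    (hdom : ∀ u ∈ C, ∀ v ∈ C, ∀ w ∈ C, G.Adj u v → G.Adj w u ∨ G.Adj w v) :
    ∃ f : V → Fin (G.cliqueNum + 1), (∀ u ∈ C, ∀ v ∈ C, G.Adj u v → f u ≠ f v) ∧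
      (∀ u ∈ C, ∀ v ∈ C, ¬ G.Adj u v → f u = f v) := by
  classical
  let r : Setoid C :=
    { r := fun u v => ¬ G.Adj u.1 v.1
      iseqv :=
        { refl := fun u => G.irrefl
          symm := fun h h' => h h'.symm
          trans := fun {x y z} h1 h2 h3 => by
            rcases hdom x x.2 z z.2 y y.2 h3 with h | h
            · exact h1 h.symm
            · exact h2 h } }
  let g : Quotient r → V := fun q => (Quotient.out q).1
  have hg : ∀ p q, p ≠ q → G.Adj (g p) (g q) := by
    intro p q hpq
    by_contra hcon
    apply hpq
    rw [← Quotient.out_eq p, ← Quotient.out_eq q]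
    exact Quotient.sound hcon
  have hginj : Function.Injective g := by
    intro p q hpq
    by_contra hne
    exact (hg p q hne).ne hpq
  have hclique : G.IsClique (Finset.univ.image g : Finset V) := by
    intro x hx y hy hxy
    simp only [Finset.coe_image, Finset.coe_univ, Set.image_univ, Set.mem_range] at hx hy
    obtain ⟨p, rfl⟩ := hx
    obtain ⟨q, rfl⟩ := hy
    exact hg p q fun h => hxy (by rw [h])
  have hcard : Fintype.card (Quotient r) ≤ G.cliqueNum := by
    have h := hclique.card_le_cliqueNum
    rwa [Finset.card_image_of_injective _ hginj, Finset.card_univ] at h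
  obtain ⟨e⟩ : Nonempty (Quotient r ↪ Fin (G.cliqueNum + 1)) :=
    Function.Embedding.nonempty_of_card_le (by simp; omega)
  refine ⟨fun v => if h : v ∈ C then e (Quotient.mk r ⟨v, h⟩) else 0, ?_, ?_⟩
  · intro u hu v hv huv heq
    simp only [hu, hv, dif_pos] at heq
    exact Quotient.exact (e.injective heq) huv
  · intro u hu v hv huv
    simp only [hu, hv, dif_pos]
    congr 1
    exact Quotient.sound huv

lemma component_color {V : Type*} [Fintype V] (G : SimpleGraph V)
    (hP5 : InducedFree G (pathGraph 5)) (hpaw : InducedFree G pawGraph)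
    (S T C : Set V) (hdisj : Disjoint S T)
    (hS : ∀ u ∈ S, ∀ w ∈ S, ¬ G.Adj u w) (hT : ∀ u ∈ T, ∀ w ∈ T, ¬ G.Adj u w)
    (hTS : ∀ t ∈ T, ∃ s ∈ S, G.Adj t s)
    (hCadj : ∀ u ∈ C, ∀ v, G.Adj u v → v ∈ C)
    (hCr : ∀ u ∈ C, ∀ v ∈ C, G.Reachable u v)
    (c0 c1 c2 : Fin (G.cliqueNum + 1)) (h01 : c0 ≠ c1) (h02 : c0 ≠ c2) (h12 : c1 ≠ c2) :
    ∃ f : V → Fin (G.cliqueNum + 1), (∀ u ∈ C, ∀ v ∈ C, G.Adj u v → f u ≠ f v) ∧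
      (∀ u ∈ S, u ∈ C → f u = c0) ∧ (∀ u ∈ T, u ∈ C → f u = c1) := by
  classical
  have hCreach : ∀ u ∈ C, ∀ v, G.Reachable u v → v ∈ C := fun u hu v h =>
    reach_induct G (· ∈ C) u v h hu fun x y hxy hx => hCadj x hx y hxy
  by_cases htri : ∃ x ∈ C, ∃ y z, G.Adj x y ∧ G.Adj x z ∧ G.Adj y z
  · obtain ⟨x0, hx0, hx0tri⟩ := htri
    have hall : ∀ x, G.Reachable x0 x → ∃ y z, G.Adj x y ∧ G.Adj x z ∧ G.Adj y z := by
      intro x hx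
      refine reach_induct G (fun x => ∃ y z, G.Adj x y ∧ G.Adj x z ∧ G.Adj y z) x0 x hx hx0tri ?_
      rintro x w hxw ⟨y, z, hy, hz, hyz⟩
      rcases paw_form G hpaw x y z w hy hz hyz hxw with h | h
      · exact ⟨x, y, hxw.symm, h, hy⟩
      · exact ⟨x, z, hxw.symm, h, hz⟩
    obtain ⟨f, hf1, hf2⟩ := multipartite_color G C (fun u hu v _ w hw huv =>
      edge_dominates G hpaw u v w
        (fun x hx => hall x ((hCr x0 hx0 u hu).trans hx)) huv (hCr u hu w hw))
    by_cases hSC : ∃ s ∈ S, s ∈ C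
    · obtain ⟨s, hs, hsC⟩ := hSC
      let σ := Equiv.swap (f s) c0
      have hσs : σ (f s) = c0 := Equiv.swap_apply_left _ _
      have hSs : ∀ u ∈ S, u ∈ C → f u = f s := fun u hu huC => hf2 u huC s hsC (hS u hu s hs)
      by_cases hTC : ∃ t ∈ T, t ∈ C
      · obtain ⟨t, ht, htC⟩ := hTC
        let τ := Equiv.swap (σ (f t)) c1
        have hTt : ∀ u ∈ T, u ∈ C → f u = f t := fun u hu huC => hf2 u huC t htC (hT u hu t ht)
        have hne : f s ≠ f t := by
          obtain ⟨s', hs', hts⟩ := hTS t ht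
          have hsC' := hCadj t htC s' hts
          rw [← hSs s' hs' hsC']
          exact hf1 s' hsC' t htC hts.symm
        refine ⟨fun v => τ (σ (f v)), ?_, ?_, ?_⟩
        · intro u hu v hv huv h
          exact hf1 u hu v hv huv (σ.injective (τ.injective h))
        · intro u hu huC
          simp only [hSs u hu huC, hσs]
          refine Equiv.swap_apply_of_ne_of_ne ?_ h01
          rw [← hσs]
          exact fun h => hne (σ.injective h)
        · intro u hu huC
          simp only [hTt u hu huC]
          exact Equiv.swap_apply_left _ _
      · refine ⟨fun v => σ (f v), ?_, ?_, ?_⟩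
        · intro u hu v hv huv h
          exact hf1 u hu v hv huv (σ.injective h)
        · intro u hu huC
          simp only [hSs u hu huC, hσs]
        · intro u hu huC
          exact absurd ⟨u, hu, huC⟩ hTC
    · refine ⟨f, hf1, fun u hu huC => absurd ⟨u, hu, huC⟩ hSC, fun u hu huC => ?_⟩
      obtain ⟨s, hs, hus⟩ := hTS u hu
      exact absurd ⟨s, hs, hCadj u huC s hus⟩ hSC
  · have htri' : ∀ x ∈ C, ∀ y z, G.Adj x y → G.Adj y z → G.Adj x z → False :=
      fun x hx y z h1 h2 h3 => htri ⟨x, hx, y, z, h1, h3, h2⟩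
    obtain ⟨X, hSX, hXA, hX, hXd⟩ := exists_max_stable G (C \ T) (S ∩ C)
      (fun v hv => ⟨hv.2, Set.disjoint_left.mp hdisj hv.1⟩)
      (fun u hu w hw => hS u hu.1 w hw.1)
    obtain ⟨Y, hTY, hYA, hY, hYd⟩ := exists_max_stable G (C \ X) (T ∩ C)
      (fun v hv => ⟨hv.2, fun h => (hXA h).2 hv.1⟩)
      (fun u hu w hw => hT u hu.1 w hw.1)
    have hrest := rest_stable G C X Y (fun v hv => (hXA hv).1) (fun v hv => (hYA hv).1) htri'
      (fun a ha c hc b d hab hcd h1 h2 h3 h4 => no_two_edges G hP5 a b c d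
        (fun x y z hx => htri' x (hCreach a ha x hx) y z) hab hcd (hCr a ha c hc) h1 h2 h3 h4)
      hX hY
      (fun v hv hvX => by
        by_cases hvT : v ∈ T
        · obtain ⟨s, hs, hvs⟩ := hTS v hvT
          exact ⟨s, hSX ⟨hs, hCadj v hv s hvs⟩, hvs⟩
        · exact hXd v ⟨hv, hvT⟩ hvX)
      (fun v hv hvX hvY => hYd v ⟨hv, hvX⟩ hvY)
      (fun v hv => (hYA hv).2)
    refine ⟨fun v => if v ∈ X then c0 else if v ∈ Y then c1 else c2, ?_, ?_, ?_⟩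
    · intro u hu v hv huv
      have e1 : u ∈ X → v ∈ X → False := fun h1 h2 => hX u h1 v h2 huv
      have e2 : u ∈ Y → v ∈ Y → False := fun h1 h2 => hY u h1 v h2 huv
      have e3 : u ∉ X → u ∉ Y → v ∉ X → v ∉ Y → False :=
        fun h1 h2 h3 h4 => hrest u v hu hv h1 h2 h3 h4 huv
      dsimp only
      split_ifs with a1 a2 a3 a4 a5 a6 <;>
        first
        | exact h01
        | exact h02
        | exact h12
        | exact h01.symm
        | exact h02.symm
        | exact h12.symm
        | exact absurd (e1 (by assumption) (by assumption)) id
        | exact absurd (e2 (by assumption) (by assumption)) id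
        | exact absurd (e3 (by assumption) (by assumption) (by assumption) (by assumption)) id
    · intro u hu huC
      simp [hSX ⟨hu, huC⟩]
    · intro u hu huC
      have h1 : u ∉ X := fun h => (hXA h).2 hu
      simp [h1, hTY ⟨hu, huC⟩]

/-- A (P₅, paw)-free graph has a proper (ω+1)-coloring in which a prescribed stable set `S`,
and a prescribed stable set `T` each of whose vertices has a neighbour in `S`,
are each monochromatic. -/
theorem p5_paw_free_coloring {V : Type*} [Fintype V] (G : SimpleGraph V)
    (hP5 : InducedFree G (pathGraph 5)) (hpaw : InducedFree G pawGraph)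
    (S T : Set V) (hdisj : Disjoint S T)
    (hS : ∀ u ∈ S, ∀ w ∈ S, ¬ G.Adj u w) (hT : ∀ u ∈ T, ∀ w ∈ T, ¬ G.Adj u w)
    (hTS : ∀ t ∈ T, ∃ s ∈ S, G.Adj t s) :
    ∃ c : G.Coloring (Fin (G.cliqueNum + 1)),
      (∀ u ∈ S, ∀ w ∈ S, c u = c w) ∧ (∀ u ∈ T, ∀ w ∈ T, c u = c w) := by
  classical
  by_cases hE : ∃ a b, G.Adj a b
  · obtain ⟨a, b, hab⟩ := hE
    have h2 : 2 ≤ G.cliqueNum := by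
      have hcl : G.IsClique ({a, b} : Finset V) := by
        simp [hab]
      have h := hcl.card_le_cliqueNum
      rwa [Finset.card_pair hab.ne] at h
    have hc : ∀ K : G.ConnectedComponent, ∃ f : V → Fin (G.cliqueNum + 1),
        (∀ u ∈ K.supp, ∀ v ∈ K.supp, G.Adj u v → f u ≠ f v) ∧
        (∀ u ∈ S, u ∈ K.supp → f u = ⟨0, by omega⟩) ∧
        (∀ u ∈ T, u ∈ K.supp → f u = ⟨1, by omega⟩) := by
      intro K
      refine component_color G hP5 hpaw S T K.supp hdisj hS hT hTS ?_ ?_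
        ⟨0, by omega⟩ ⟨1, by omega⟩ ⟨2, by omega⟩ (by simp) (by simp) (by simp)
      · intro u hu v huv
        rw [ConnectedComponent.mem_supp_iff] at hu ⊢
        rw [← hu]
        exact ConnectedComponent.sound huv.symm.reachable
      · intro u hu v hv
        rw [ConnectedComponent.mem_supp_iff] at hu hv
        exact ConnectedComponent.exact (hu.trans hv.symm)
    choose f hf1 hf2 hf3 using hc
    refine ⟨Coloring.mk (fun v => f (G.connectedComponentMk v) v) ?_, ?_, ?_⟩
    · intro u v huv
      have h : G.connectedComponentMk u = G.connectedComponentMk v :=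
        ConnectedComponent.sound huv.reachable
      rw [h]
      exact hf1 _ u h v rfl huv
    · intro u hu w hw
      exact (hf2 _ u hu rfl).trans (hf2 _ w hw rfl).symm
    · intro u hu w hw
      exact (hf3 _ u hu rfl).trans (hf3 _ w hw rfl).symm
  · refine ⟨Coloring.mk (fun _ => 0) ?_, fun _ _ _ _ => rfl, fun _ _ _ _ => rfl⟩
    intro u v huv
    exact absurd ⟨u, v, huv⟩ hE
end

section
/- Let G be a connected (P_5, HVN)-free graph, let H be an induced subgraph of G containing an induced paw, and let S be the set of vertices with no neighbour in H. Then the induced subgraph G[S] is ω(G)-colorable. -/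
open SimpleGraph

/-- Elementwise form of having no induced paw. -/
def NoPaw {W : Type*} (H : SimpleGraph W) : Prop :=
  ∀ a b c d, H.Adj a b → H.Adj a c → H.Adj b c → H.Adj a d → ¬ H.Adj b d → ¬ H.Adj c d → False

/-- Elementwise form of having no induced path on five vertices. -/
def NoP5 {W : Type*} (H : SimpleGraph W) : Prop :=
  ∀ a b c d e, H.Adj a b → H.Adj b c → H.Adj c d → H.Adj d e →
    ¬ H.Adj a c → ¬ H.Adj a d → ¬ H.Adj a e → ¬ H.Adj b d → ¬ H.Adj b e → ¬ H.Adj c e → False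

/-- Elementwise form of having no induced HVN. -/
def NoHVN {W : Type*} (H : SimpleGraph W) : Prop :=
  ∀ a b c d e, H.Adj a b → H.Adj a c → H.Adj a d → H.Adj b c → H.Adj b d → H.Adj c d →
    H.Adj e a → H.Adj e b → ¬ H.Adj e c → ¬ H.Adj e d → False

lemma noP5_of_free {V : Type*} {G : SimpleGraph V} (h : InducedFree G (pathGraph 5)) :
    NoP5 G := by
  intro a b c d e ab bc cd de ac ad ae bd be ce
  apply h
  have n1 := ab.ne
  have n2 := bc.ne
  have n3 := cd.ne
  have n4 := de.ne
  have n5 : a ≠ c := by rintro rfl; exact ad cd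
  have n6 : a ≠ d := by rintro rfl; exact ac cd.symm
  have n7 : a ≠ e := by rintro rfl; exact ad de.symm
  have n8 : b ≠ d := by rintro rfl; exact be de
  have n9 : b ≠ e := by rintro rfl; exact ae ab
  have n10 : c ≠ e := by rintro rfl; exact be bc
  have := ab.symm
  have := bc.symm
  have := cd.symm
  have := de.symm
  have ac' := mt (fun h : G.Adj c a => h.symm) ac
  have ad' := mt (fun h : G.Adj d a => h.symm) ad
  have ae' := mt (fun h : G.Adj e a => h.symm) ae
  have bd' := mt (fun h : G.Adj d b => h.symm) bd
  have be' := mt (fun h : G.Adj e b => h.symm) be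
  have ce' := mt (fun h : G.Adj e c => h.symm) ce
  refine ⟨⟨![a, b, c, d, e], ?_⟩, ?_⟩
  · intro i j hij
    fin_cases i <;> fin_cases j <;> simp_all
  · intro i j
    change _ ↔ G.Adj (![a, b, c, d, e] i) (![a, b, c, d, e] j)
    clear h
    fin_cases i <;> fin_cases j <;> simp_all [pathGraph_adj]

lemma noHVN_of_free {V : Type*} {G : SimpleGraph V} (h : InducedFree G hvnGraph) :
    NoHVN G := by
  intro a b c d e ab ac ad bc bd cd ea eb ec ed
  apply h
  have n1 := ab.ne
  have n2 := ac.ne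
  have n3 := ad.ne
  have n4 := bc.ne
  have n5 := bd.ne
  have n6 := cd.ne
  have n7 := ea.ne
  have n8 := eb.ne
  have n9 : e ≠ c := by rintro rfl; exact ed cd
  have n10 : e ≠ d := by rintro rfl; exact ec cd.symm
  have := ab.symm
  have := ac.symm
  have := ad.symm
  have := bc.symm
  have := bd.symm
  have := cd.symm
  have := ea.symm
  have := eb.symm
  have ec' := mt (fun h : G.Adj c e => h.symm) ec
  have ed' := mt (fun h : G.Adj d e => h.symm) ed
  refine ⟨⟨![a, b, c, d, e], ?_⟩, ?_⟩
  · intro i j hij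
    fin_cases i <;> fin_cases j <;> simp_all
  · intro i j
    change _ ↔ G.Adj (![a, b, c, d, e] i) (![a, b, c, d, e] j)
    clear h
    fin_cases i <;> fin_cases j <;> simp_all [hvnGraph]

lemma exists_boundary {W : Type*} {H : SimpleGraph W} (hc : H.Connected) (P : W → Prop)
    {a b : W} (ha : P a) (hb : ¬ P b) : ∃ u v, H.Adj u v ∧ P u ∧ ¬ P v := by
  obtain ⟨p⟩ := hc.preconnected a b
  obtain ⟨d, -, h1, h2⟩ := p.exists_boundary_dart {x | P x} ha hb
  exact ⟨d.fst, d.snd, d.adj, h1, h2⟩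

/-- A connected paw-free graph with a triangle is complete multipartite. -/
lemma multipartite_of_triangle {W : Type*} {H : SimpleGraph W} (hc : H.Connected)
    (hp : NoPaw H) {a b c : W} (ab : H.Adj a b) (ac : H.Adj a c) (bc : H.Adj b c) :
    H.IsCompleteMultipartite := by
  have tri : ∀ x, ∃ y z, H.Adj x y ∧ H.Adj x z ∧ H.Adj y z := by
    intro x
    by_contra hx
    obtain ⟨u, v, uv, ⟨y, z, uy, uz, yz⟩, hv⟩ :=
      exists_boundary hc (fun x => ∃ y z, H.Adj x y ∧ H.Adj x z ∧ H.Adj y z)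
        ⟨b, c, ab, ac, bc⟩ hx
    apply hv
    by_cases h1 : H.Adj y v
    · exact ⟨u, y, uv.symm, h1.symm, uy⟩
    by_cases h2 : H.Adj z v
    · exact ⟨u, z, uv.symm, h2.symm, uz⟩
    exact (hp u y z v uy uz yz uv h1 h2).elim
  have etri : ∀ u v, H.Adj u v → ∃ t, H.Adj u t ∧ H.Adj v t := by
    intro u v uv
    obtain ⟨y, z, uy, uz, yz⟩ := tri u
    by_cases h1 : H.Adj y v
    · exact ⟨y, uy, h1.symm⟩
    by_cases h2 : H.Adj z v
    · exact ⟨z, uz, h2.symm⟩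
    exact (hp u y z v uy uz yz uv h1 h2).elim
  have key : ∀ a c d b, H.Adj a c → H.Adj d b → H.Adj d a → ¬ H.Adj b a → ¬ H.Adj b c →
      False := by
    intro a c d b ac db da nba nbc
    have nab : ¬ H.Adj a b := fun h => nba h.symm
    have ncb : ¬ H.Adj c b := fun h => nbc h.symm
    by_cases dc : H.Adj d c
    · exact hp d a c b da dc ac db nab ncb
    obtain ⟨t, dt, at'⟩ := etri d a da
    by_cases tb : H.Adj t b
    · by_cases tc : H.Adj t c
      · exact hp t a c b at'.symm tc ac tb nab ncb
      · exact hp a d t c da.symm at' dt ac dc tc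
    · exact hp d a t b da dt at' db nab tb
  refine ⟨fun x y z nxy nyz xz => ?_⟩
  obtain ⟨u, v, uv, hu, hv⟩ := exists_boundary hc (fun w => H.Adj w x ∨ H.Adj w z)
    (a := x) (b := y) (Or.inr xz) (fun h => h.elim (fun h => nxy h.symm) nyz)
  simp only [not_or] at hv
  rcases hu with hu | hu
  · exact key x z u v xz uv hu hv.1 hv.2
  · exact key z x u v xz.symm uv hu hv.2 hv.1

lemma colorable_of_C5 {W : Type*} {H : SimpleGraph W} (hc : H.Connected)
    (h5 : NoP5 H) (ht : ∀ a b c, H.Adj a b → H.Adj a c → H.Adj b c → False)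
    {a b c d e : W} (ab : H.Adj a b) (bc : H.Adj b c) (cd : H.Adj c d) (de : H.Adj d e)
    (ea : H.Adj e a) : H.Colorable 3 := by
  classical
  have nac : ¬ H.Adj a c := fun h => ht _ _ _ ab h bc
  have nbd : ¬ H.Adj b d := fun h => ht _ _ _ bc h cd
  have nce : ¬ H.Adj c e := fun h => ht _ _ _ cd h de
  have nda : ¬ H.Adj d a := fun h => ht _ _ _ de h ea
  have neb : ¬ H.Adj e b := fun h => ht _ _ _ ea h ab
  -- one step: an outside vertex adjacent to a cycle vertex
  have step : ∀ a b c d e y, H.Adj a b → H.Adj b c → H.Adj c d → H.Adj d e → H.Adj e a →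
      H.Adj y a → H.Adj y c ∨ H.Adj y d := by
    intro a b c d e y ab bc cd de ea ya
    by_contra hcon
    rw [not_or] at hcon
    exact h5 y a b c d ya ab bc cd (fun h => ht _ _ _ ya h ab) hcon.1 hcon.2
      (fun h => ht _ _ _ ab h bc) (fun h => ht _ _ _ de h.symm ea) (fun h => ht _ _ _ bc h cd)
  have far : ∀ a b c d e x y, H.Adj a b → H.Adj b c → H.Adj c d → H.Adj d e → H.Adj e a →
      H.Adj x b → H.Adj x e → H.Adj x y → ¬ H.Adj y b → ¬ H.Adj y c → ¬ H.Adj y d → False := by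
    intro a b c d e x y ab bc cd de ea xb xe xy nb nc nd
    exact h5 y x b c d xy.symm xb bc cd nb nc nd (fun h => ht _ _ _ xb h bc)
      (fun h => ht _ _ _ xe h de.symm) (fun h => ht _ _ _ bc h cd)
  let P : W → Prop := fun x => (H.Adj x e ∧ H.Adj x b) ∨ (H.Adj x a ∧ H.Adj x c) ∨
    (H.Adj x b ∧ H.Adj x d) ∨ (H.Adj x c ∧ H.Adj x e) ∨ (H.Adj x d ∧ H.Adj x a)
  have all : ∀ x, P x := by
    intro x
    by_contra hx
    obtain ⟨u, v, uv, hu, hv⟩ := exists_boundary hc P (a := a) (b := x)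
      (Or.inl ⟨ea.symm, ab⟩) hx
    have s1 := step a b c d e v ab bc cd de ea
    have s2 := step b c d e a v bc cd de ea ab
    have s3 := step c d e a b v cd de ea ab bc
    have s4 := step d e a b c v de ea ab bc cd
    have s5 := step e a b c d v ea ab bc cd de
    have na : ¬ H.Adj v a := fun h => hv ((s1 h).elim
      (fun k => Or.inr (Or.inl ⟨h, k⟩)) (fun k => Or.inr (Or.inr (Or.inr (Or.inr ⟨k, h⟩)))))
    have nb : ¬ H.Adj v b := fun h => hv ((s2 h).elim
      (fun k => Or.inr (Or.inr (Or.inl ⟨h, k⟩))) (fun k => Or.inl ⟨k, h⟩))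
    have nc : ¬ H.Adj v c := fun h => hv ((s3 h).elim
      (fun k => Or.inr (Or.inr (Or.inr (Or.inl ⟨h, k⟩)))) (fun k => Or.inr (Or.inl ⟨k, h⟩)))
    have nd : ¬ H.Adj v d := fun h => hv ((s4 h).elim
      (fun k => Or.inr (Or.inr (Or.inr (Or.inr ⟨h, k⟩)))) (fun k => Or.inr (Or.inr (Or.inl ⟨k, h⟩))))
    have ne : ¬ H.Adj v e := fun h => hv ((s5 h).elim
      (fun k => Or.inl ⟨h, k⟩) (fun k => Or.inr (Or.inr (Or.inr (Or.inl ⟨k, h⟩)))))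
    rcases hu with h | h | h | h | h
    · exact far a b c d e u v ab bc cd de ea h.2 h.1 uv nb nc nd
    · exact far b c d e a u v bc cd de ea ab h.2 h.1 uv nc nd ne
    · exact far c d e a b u v cd de ea ab bc h.2 h.1 uv nd ne na
    · exact far d e a b c u v de ea ab bc cd h.2 h.1 uv ne na nb
    · exact far e a b c d u v ea ab bc cd de h.2 h.1 uv na nb nc
  refine ⟨Coloring.mk (fun x => if H.Adj x b then (0 : Fin 3) else if H.Adj x c then 1 else 2) ?_⟩
  intro x y xy
  have hx := all x
  have hy := all y
  have tb := ht x y b xy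
  have tc := ht x y c xy
  have ta := ht x y a xy
  simp only [P] at hx hy
  clear far step all h5 hc
  clear P nac nbd nce nda neb ab bc cd de ea ht xy
  by_cases h1 : H.Adj x b <;> by_cases h2 : H.Adj y b <;> by_cases h3 : H.Adj x c <;>
    by_cases h4 : H.Adj y c <;> simp [h1, h2, h3, h4] <;> tauto

/-- A vertex at positive distance has a parent. -/
lemma exists_parent {W : Type*} {H : SimpleGraph W} (hc : H.Connected) (r x : W) {k : ℕ}
    (hk : H.dist r x = k + 1) : ∃ y, H.Adj y x ∧ H.dist r y = k := by
  obtain ⟨p, hp⟩ := hc.exists_walk_length_eq_dist x r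
  rw [dist_comm, hk] at hp
  cases p with
  | nil => simp at hp
  | @cons _ y _ h q =>
    refine ⟨y, h.symm, ?_⟩
    have h1 : H.dist y r ≤ q.length := dist_le q
    have h2 := hc.dist_triangle (u := r) (v := y) (w := x)
    have h3 : H.dist y x = 1 := dist_eq_one_iff_adj.2 h.symm
    rw [dist_comm] at h1
    simp only [Walk.length_cons] at hp
    omega

lemma adj_dist_le {W : Type*} {H : SimpleGraph W} (hc : H.Connected) (r : W) {x y : W}
    (h : H.Adj x y) : H.dist r y ≤ H.dist r x + 1 := by
  have h2 := hc.dist_triangle (u := r) (v := x) (w := y)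
  rwa [dist_eq_one_iff_adj.2 h] at h2

lemma colorable_of_triangleFree {W : Type*} {H : SimpleGraph W} (hc : H.Connected)
    (h5 : NoP5 H) (ht : ∀ a b c, H.Adj a b → H.Adj a c → H.Adj b c → False) :
    H.Colorable 3 := by
  classical
  by_cases hC : ∃ a b c d e, H.Adj a b ∧ H.Adj b c ∧ H.Adj c d ∧ H.Adj d e ∧ H.Adj e a
  · obtain ⟨a, b, c, d, e, ab, bc, cd, de, ea⟩ := hC
    exact colorable_of_C5 hc h5 ht ab bc cd de ea
  obtain ⟨r⟩ := hc.nonempty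
  have lev : ∀ x y, H.Adj x y → H.dist r x ≠ H.dist r y := by
    intro x y xy he
    have far : ∀ u v, H.dist r v + 2 ≤ H.dist r u → ¬ H.Adj u v := fun u v h1 h2 => by
      have := adj_dist_le hc r h2.symm
      omega
    rcases hk : H.dist r x with _ | k
    · have h1 := (hc.dist_eq_zero_iff).1 hk
      have h2 := (hc.dist_eq_zero_iff).1 (he ▸ hk)
      exact xy.ne (h1 ▸ h2)
    obtain ⟨p, px, hp⟩ := exists_parent hc r x hk
    obtain ⟨q, qy, hq⟩ := exists_parent hc r y (he ▸ hk)
    rcases k with _ | k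
    · have h1 := (hc.dist_eq_zero_iff).1 hp
      have h2 := (hc.dist_eq_zero_iff).1 hq
      subst h1; subst h2
      exact ht _ _ _ px qy xy
    obtain ⟨p', pp, hp'⟩ := exists_parent hc r p hp
    obtain ⟨q', qq, hq'⟩ := exists_parent hc r q hq
    rcases k with _ | k
    · have h1 := (hc.dist_eq_zero_iff).1 hp'
      have h2 := (hc.dist_eq_zero_iff).1 hq'
      subst h1; subst h2
      exact hC ⟨_, _, _, _, _, pp, px, xy, qy.symm, qq.symm⟩
    obtain ⟨p'', ppp, hp''⟩ := exists_parent hc r p' hp'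
    exact h5 y x p p' p'' xy.symm px.symm pp.symm ppp.symm
      (fun h => ht _ _ _ px h.symm xy) (far _ _ (by omega)) (far _ _ (by omega))
      (far _ _ (by omega)) (far _ _ (by omega)) (far _ _ (by omega))
  refine ⟨Coloring.mk (fun x => if H.dist r x % 2 = 0 then (0 : Fin 3) else 1) ?_⟩
  intro x y xy
  have h1 := lev x y xy
  have h2 := adj_dist_le hc r xy
  have h3 := adj_dist_le hc r xy.symm
  by_cases h4 : H.dist r x % 2 = 0 <;> by_cases h6 : H.dist r y % 2 = 0 <;> simp [h4, h6] <;>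
    omega

lemma colorable_connected {W : Type*} {H : SimpleGraph W} (hc : H.Connected)
    (h5 : NoP5 H) (hp : NoPaw H) {n : ℕ} (hn : 3 ≤ n) (hcl : H.CliqueFree (n + 1)) :
    H.Colorable n := by
  by_cases ht : ∀ a b c, H.Adj a b → H.Adj a c → H.Adj b c → False
  · exact (colorable_of_triangleFree hc h5 ht).mono hn
  · push Not at ht
    obtain ⟨a, b, c, ab, ac, bc, -⟩ := ht
    exact (multipartite_of_triangle hc hp ab ac bc).colorable_of_cliqueFree hcl

/-- In a connected (P₅, HVN)-free graph, if `A` induces a subgraph containing an induced paw,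
then the subgraph induced on the set of vertices with no neighbour in `A` is ω(G)-colorable. -/
theorem no_nbr_colorable {V : Type*} [Fintype V] (G : SimpleGraph V) (hconn : G.Connected)
    (hP5 : InducedFree G (pathGraph 5)) (hHVN : InducedFree G hvnGraph)
    (A : Set V)
    (hpaw : ∃ f : Fin 4 ↪ V, (∀ a, f a ∈ A) ∧
      ∀ a b, pawGraph.Adj a b ↔ G.Adj (f a) (f b)) :
    (G.induce {u : V | ∀ a ∈ A, ¬ G.Adj u a}).Colorable G.cliqueNum := by
  classical
  have h5 := noP5_of_free hP5
  have hv := noHVN_of_free hHVN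
  obtain ⟨f, fA, hf⟩ := hpaw
  obtain ⟨p0, hp0⟩ : ∃ p, p = f 0 := ⟨_, rfl⟩
  obtain ⟨p1, hp1⟩ : ∃ p, p = f 1 := ⟨_, rfl⟩
  obtain ⟨p2, hp2⟩ : ∃ p, p = f 2 := ⟨_, rfl⟩
  obtain ⟨p3, hp3⟩ : ∃ p, p = f 3 := ⟨_, rfl⟩
  have e01 : G.Adj p0 p1 := by rw [hp0, hp1, ← hf]; simp [pawGraph]
  have e02 : G.Adj p0 p2 := by rw [hp0, hp2, ← hf]; simp [pawGraph]
  have e12 : G.Adj p1 p2 := by rw [hp1, hp2, ← hf]; simp [pawGraph]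
  have e03 : G.Adj p0 p3 := by rw [hp0, hp3, ← hf]; simp [pawGraph]
  have e13 : ¬ G.Adj p1 p3 := by rw [hp1, hp3, ← hf]; simp [pawGraph]
  have e23 : ¬ G.Adj p2 p3 := by rw [hp2, hp3, ← hf]; simp [pawGraph]
  have A0 : p0 ∈ A := hp0 ▸ fA 0
  have A1 : p1 ∈ A := hp1 ▸ fA 1
  have A2 : p2 ∈ A := hp2 ▸ fA 2
  have A3 : p3 ∈ A := hp3 ▸ fA 3
  clear hp0 hp1 hp2 hp3 fA hf f hP5 hHVN
  have hn : 3 ≤ G.cliqueNum := by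
    have h3 : G.IsNClique 3 {p0, p1, p2} := is3Clique_triple_iff.2 ⟨e01, e02, e12⟩
    rw [← h3.card_eq]
    exact IsClique.card_le_cliqueNum (tc := h3.isClique)
  have hcl : G.CliqueFree (G.cliqueNum + 1) := by
    intro s hs
    have := IsClique.card_le_cliqueNum (tc := hs.isClique)
    rw [hs.card_eq] at this
    omega
  -- pass to the vertices without neighbour in the paw
  set S : Set V := {u : V | ¬ G.Adj u p0 ∧ ¬ G.Adj u p1 ∧ ¬ G.Adj u p2 ∧ ¬ G.Adj u p3} with hS
  have hsub : {u : V | ∀ a ∈ A, ¬ G.Adj u a} ⊆ S :=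
    fun u hu => ⟨hu _ A0, hu _ A1, hu _ A2, hu _ A3⟩
  refine Colorable.of_hom (G' := G.induce S) (G.induceHomOfLE hsub).toHom ?_
  rw [colorable_iff_forall_connectedComponent]
  intro C
  have hC := C.connected_toSimpleGraph
  have adjC : ∀ u v : C, C.toSimpleGraph.Adj u v ↔ G.Adj u.1.1 v.1.1 := fun u v => Iff.rfl
  -- a vertex with a neighbour in the component, outside of `S`
  obtain ⟨c0⟩ := hC.nonempty
  obtain ⟨x, y, xy, ⟨cx, rfl⟩, hy⟩ := exists_boundary hconn
    (fun v => ∃ c : C, c.1.1 = v) (a := c0.1.1) (b := p0) ⟨c0, rfl⟩ (by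
      rintro ⟨c, hc⟩
      exact c.1.2.2.1 (hc ▸ e01))
  have hyS : y ∉ S := by
    intro hyS
    apply hy
    have hadj : (G.induce S).Adj cx.1 ⟨y, hyS⟩ := xy
    exact ⟨⟨⟨y, hyS⟩, C.mem_supp_of_adj_mem_supp cx.2 hadj⟩, rfl⟩
  -- it has an adjacent pair in the paw on which it is mixed
  obtain ⟨p, q, pq, yp, yq, hp, hq⟩ : ∃ p q, G.Adj p q ∧ G.Adj y p ∧ ¬ G.Adj y q ∧
      (∀ u ∈ S, ¬ G.Adj u p) ∧ (∀ u ∈ S, ¬ G.Adj u q) := by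
    have s0 : ∀ u ∈ S, ¬ G.Adj u p0 := fun u hu => hu.1
    have s1 : ∀ u ∈ S, ¬ G.Adj u p1 := fun u hu => hu.2.1
    have s2 : ∀ u ∈ S, ¬ G.Adj u p2 := fun u hu => hu.2.2.1
    have s3 : ∀ u ∈ S, ¬ G.Adj u p3 := fun u hu => hu.2.2.2
    by_cases a0 : G.Adj y p0
    · by_cases a1 : G.Adj y p1
      · by_cases a2 : G.Adj y p2
        · by_cases a3 : G.Adj y p3
          · exact (hv p0 y p1 p2 p3 a0.symm e01 e02 a1 a2 e12 e03.symm a3.symm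
              (fun h => e13 h.symm) (fun h => e23 h.symm)).elim
          · exact ⟨_, _, e03, a0, a3, s0, s3⟩
        · exact ⟨_, _, e02, a0, a2, s0, s2⟩
      · exact ⟨_, _, e01, a0, a1, s0, s1⟩
    · by_cases a1 : G.Adj y p1
      · exact ⟨_, _, e01.symm, a1, a0, s1, s0⟩
      by_cases a2 : G.Adj y p2
      · exact ⟨_, _, e02.symm, a2, a0, s2, s0⟩
      by_cases a3 : G.Adj y p3
      · exact ⟨_, _, e03.symm, a3, a0, s3, s0⟩
      exact (hyS ⟨a0, a1, a2, a3⟩).elim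
  have compl : ∀ c : C, G.Adj c.1.1 y := by
    intro c
    by_contra hc
    obtain ⟨u, v, uv, hu, hv⟩ := exists_boundary hC (fun c : C => G.Adj c.1.1 y) xy hc
    exact h5 v.1.1 u.1.1 y p q ((adjC _ _).1 uv).symm hu yp pq hv (hp _ v.1.2) (hq _ v.1.2)
      (hp _ u.1.2) (hq _ u.1.2) yq
  refine colorable_connected hC ?_ ?_ hn ?_
  · intro a b c d e
    simp only [adjC]
    exact h5 _ _ _ _ _
  · intro a b c d
    simp only [adjC]
    intro ab ac bc ad bd cd
    exact hv a.1.1 y b.1.1 c.1.1 d.1.1 (compl a) ab ac (compl b).symm (compl c).symm bc ad.symm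
      (compl d) (fun h => bd h.symm) (fun h => cd h.symm)
  · exact (hcl.comap (Embedding.induce S).isContained).comap (Embedding.induce C.supp).isContained
end

section
/- Let G be a (P_5, HVN)-free graph that contains an induced T-5-wheel. Then χ(G) ≤ ω(G) + 3. -/
open SimpleGraph

namespace PH
universe u
variable {V : Type u} {G : SimpleGraph V}

/-- no induced P5 -/
def P5f (G : SimpleGraph V) : Prop := ∀ a b c d e, G.Adj a b → G.Adj b c → G.Adj c d → G.Adj d e →
  ¬ G.Adj a c → ¬ G.Adj a d → ¬ G.Adj a e → ¬ G.Adj b d → ¬ G.Adj b e → ¬ G.Adj c e → False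

/-- no induced HVN -/
def HVNf (G : SimpleGraph V) : Prop := ∀ a b c d e, G.Adj a b → G.Adj a c → G.Adj a d → G.Adj b c →
  G.Adj b d → G.Adj c d → G.Adj e a → G.Adj e b → ¬ G.Adj e c → ¬ G.Adj e d → False

/-- no K4 -/
def K4f (G : SimpleGraph V) : Prop := ∀ a b c d, G.Adj a b → G.Adj a c → G.Adj a d → G.Adj b c →
  G.Adj b d → G.Adj c d → False

/-- induced five-cycle -/
structure C5 (G : SimpleGraph V) (a b c d e : V) : Prop where
  ab : G.Adj a b
  bc : G.Adj b c
  cd : G.Adj c d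
  de : G.Adj d e
  ea : G.Adj e a
  ac : ¬ G.Adj a c
  ad : ¬ G.Adj a d
  bd : ¬ G.Adj b d
  be : ¬ G.Adj b e
  ce : ¬ G.Adj c e

lemma C5.rot {a b c d e : V} (h : C5 G a b c d e) : C5 G b c d e a :=
  ⟨h.bc, h.cd, h.de, h.ea, h.ab, h.bd, h.be, h.ce, fun x => h.ac x.symm, fun x => h.ad x.symm⟩

lemma C5.refl {a b c d e : V} (h : C5 G a b c d e) : C5 G a e d c b :=
  ⟨h.ea.symm, h.de.symm, h.cd.symm, h.bc.symm, h.ab.symm, h.ad, h.ac,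
    fun x => h.ce x.symm, fun x => h.be x.symm, fun x => h.bd x.symm⟩

/-- the graph restricted to a set -/
def Rg (G : SimpleGraph V) (S : Set V) : SimpleGraph V where
  Adj u v := G.Adj u v ∧ u ∈ S ∧ v ∈ S
  symm := ⟨fun _ _ h => ⟨h.1.symm, h.2.2, h.2.1⟩⟩
  loopless := ⟨fun _ h => G.loopless.irrefl _ h.1⟩

lemma reach_const {H : SimpleGraph V} {P : V → Prop} (hP : ∀ a b, H.Adj a b → P a → P b)
    {x y : V} (h : H.Reachable x y) (hx : P x) : P y := by
  obtain ⟨w⟩ := h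
  induction w with
  | nil => exact hx
  | cons h p ih => exact ih (hP _ _ h hx)

lemma boundary {H : SimpleGraph V} {P : V → Prop} {x y : V} (h : H.Reachable x y) (hx : P x)
    (hy : ¬ P y) : ∃ a b, H.Reachable x a ∧ H.Adj a b ∧ P a ∧ ¬ P b := by
  by_contra hc
  push Not at hc
  have := reach_const (P := fun v => H.Reachable x v ∧ P v)
    (fun a b hab h => ⟨h.1.trans hab.reachable, hc a b h.1 hab h.2⟩) h ⟨Reachable.refl _, hx⟩
  exact hy this.2

lemma reach_mem {S : Set V} {x y : V} (h : (Rg G S).Reachable x y) (hx : x ∈ S) : y ∈ S :=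
  reach_const (H := Rg G S) (P := fun v => v ∈ S) (fun _ _ hab _ => hab.2.2) h hx

lemma rg_mono {S T : Set V} (hST : S ⊆ T) {x y : V} (h : (Rg G S).Reachable x y) :
    (Rg G T).Reachable x y :=
  have : Rg G S ≤ Rg G T := fun _ _ hab => ⟨hab.1, hST hab.2.1, hST hab.2.2⟩
  h.mono this

/-- attachment rule to a five-cycle -/
lemma C5.att (hP : P5f G) {a b c d e x : V} (h : C5 G a b c d e) (hx : G.Adj x a) :
    G.Adj x b ∨ G.Adj x c ∨ G.Adj x d := by
  by_contra hc
  push Not at hc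
  exact hP x a b c d hx h.ab h.bc h.cd hc.1 hc.2.1 hc.2.2 h.ac h.ad h.bd

/-- triangle-free on S -/
def TFr (G : SimpleGraph V) (S : Set V) : Prop :=
  ∀ a ∈ S, ∀ b ∈ S, ∀ c ∈ S, G.Adj a b → G.Adj b c → G.Adj a c → False

lemma C5.pat (hP : P5f G) {S : Set V} (hS : TFr G S) {a b c d e x : V} (h : C5 G a b c d e)
    (ha : a ∈ S) (hb : b ∈ S) (hc : c ∈ S) (hd : d ∈ S) (he : e ∈ S) (hx : x ∈ S) :
    (¬ G.Adj x a ∧ ¬ G.Adj x b ∧ ¬ G.Adj x c ∧ ¬ G.Adj x d ∧ ¬ G.Adj x e) ∨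
    (¬ G.Adj x a ∧ G.Adj x b ∧ ¬ G.Adj x c ∧ ¬ G.Adj x d ∧ G.Adj x e) ∨
    (G.Adj x a ∧ ¬ G.Adj x b ∧ G.Adj x c ∧ ¬ G.Adj x d ∧ ¬ G.Adj x e) ∨
    (¬ G.Adj x a ∧ G.Adj x b ∧ ¬ G.Adj x c ∧ G.Adj x d ∧ ¬ G.Adj x e) ∨
    (¬ G.Adj x a ∧ ¬ G.Adj x b ∧ G.Adj x c ∧ ¬ G.Adj x d ∧ G.Adj x e) ∨
    (G.Adj x a ∧ ¬ G.Adj x b ∧ ¬ G.Adj x c ∧ G.Adj x d ∧ ¬ G.Adj x e) := by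
  have t1 : ¬ (G.Adj x a ∧ G.Adj x b) := fun k => hS x hx a ha b hb k.1 h.ab k.2
  have t2 : ¬ (G.Adj x b ∧ G.Adj x c) := fun k => hS x hx b hb c hc k.1 h.bc k.2
  have t3 : ¬ (G.Adj x c ∧ G.Adj x d) := fun k => hS x hx c hc d hd k.1 h.cd k.2
  have t4 : ¬ (G.Adj x d ∧ G.Adj x e) := fun k => hS x hx d hd e he k.1 h.de k.2
  have t5 : ¬ (G.Adj x e ∧ G.Adj x a) := fun k => hS x hx e he a ha k.1 h.ea k.2
  have r1 := C5.att hP (x := x) h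
  have r2 := C5.att hP (x := x) h.rot
  have r3 := C5.att hP (x := x) h.rot.rot
  have r4 := C5.att hP (x := x) h.rot.rot.rot
  have r5 := C5.att hP (x := x) h.rot.rot.rot.rot
  by_cases p1 : G.Adj x a <;> by_cases p2 : G.Adj x b <;> by_cases p3 : G.Adj x c <;>
  by_cases p4 : G.Adj x d <;> by_cases p5 : G.Adj x e <;> simp_all

lemma parent {H : SimpleGraph V} {r v : V} {n : ℕ} (hr : H.Reachable r v) (h : H.dist r v = n + 1) :
    ∃ p, H.Adj v p ∧ H.dist r p = n ∧ H.Reachable r p := by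
  obtain ⟨w, hw⟩ := hr.symm.exists_walk_length_eq_dist
  rw [dist_comm, h] at hw
  cases w with
  | nil => simp at hw
  | cons hadj q =>
    refine ⟨_, hadj, ?_, hr.trans hadj.reachable⟩
    simp at hw
    have h1 := dist_le q
    rw [dist_comm] at h1
    have := hadj.diff_dist_adj (u := r)
    omega

/-- `S` contains an induced C5 -/
def HasC5 (G : SimpleGraph V) (S : Set V) : Prop :=
  ∃ a ∈ S, ∃ b ∈ S, ∃ c ∈ S, ∃ d ∈ S, ∃ e ∈ S, C5 G a b c d e

lemma par_proper (hP : P5f G) {S : Set V} (hS : TFr G S) {r : V} (hr : r ∈ S)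
    (hno : ¬ ∃ a b c d e, C5 G a b c d e ∧ b ∈ S ∧ c ∈ S ∧ d ∈ S ∧ e ∈ S ∧ a ∈ S ∧
      (Rg G S).Reachable r a)
    {u v : V} (hu : (Rg G S).Reachable r u) (huv : (Rg G S).Adj u v) :
    (Rg G S).dist r u % 2 ≠ (Rg G S).dist r v % 2 := by
  intro heq
  have hv := hu.trans huv.reachable
  set H := Rg G S with hH
  have lev : ∀ x y, x ∈ S → y ∈ S → G.Adj x y → H.dist r x ≤ H.dist r y + 1 ∧
      H.dist r y ≤ H.dist r x + 1 := by
    intro x y hx hy hxy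
    have : H.Adj x y := ⟨hxy, hx, hy⟩
    have := this.diff_dist_adj (u := r)
    omega
  have hd := lev u v huv.2.1 huv.2.2 huv.1
  have hd' : H.dist r u = H.dist r v := by omega
  have h0 : H.dist r r = 0 := dist_self
  obtain hn | hn | hn | ⟨n, hn⟩ : H.dist r u = 0 ∨ H.dist r u = 1 ∨ H.dist r u = 2 ∨
      ∃ n, H.dist r u = n + 3 := by
    rcases hh : H.dist r u with _ | _ | _ | n
    · simp
    · simp
    · simp
    · right; right; right; exact ⟨n, rfl⟩
  · have e1 := (hu.dist_eq_zero_iff).1 hn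
    have e2 := (hv.dist_eq_zero_iff).1 (hd' ▸ hn)
    subst e1; subst e2; exact G.loopless.irrefl _ huv.1
  · obtain ⟨p, hp, hp0, hpr⟩ := parent hu hn
    obtain ⟨q, hq, hq0, hqr⟩ := parent hv (hd' ▸ hn)
    have e1 := (hpr.dist_eq_zero_iff).1 hp0
    have e2 := (hqr.dist_eq_zero_iff).1 hq0
    subst e1; subst e2
    exact hS _ hr _ huv.2.1 _ huv.2.2 hp.1.symm huv.1 hq.1.symm
  · obtain ⟨p, hp, hp0, hpr⟩ := parent hu hn
    obtain ⟨q, hq, hq0, hqr⟩ := parent hv (hd' ▸ hn)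
    obtain ⟨p', hp', hp0', hpr'⟩ := parent hpr hp0
    obtain ⟨q', hq', hq0', hqr'⟩ := parent hqr hq0
    have e1 := (hpr'.dist_eq_zero_iff).1 hp0'
    have e2 := (hqr'.dist_eq_zero_iff).1 hq0'
    subst e1; subst e2
    apply hno
    refine ⟨_, p, u, v, q, ⟨hp'.1.symm, hp.1.symm, huv.1, hq.1, hq'.1, ?_, ?_, ?_, ?_, ?_⟩, hp.2.2,
      huv.2.1, huv.2.2, hq.2.2, hr, Reachable.refl _⟩
    · intro h; have := lev _ _ hr huv.2.1 h; omega
    · intro h; have := lev _ _ hr huv.2.2 h; omega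
    · intro h; exact hS _ hp.2.2 _ huv.2.1 _ huv.2.2 hp.1.symm huv.1 h
    · intro h; exact hS _ hr _ hp.2.2 _ hq.2.2 hp'.1.symm h hq'.1.symm
    · intro h; exact hS _ huv.2.1 _ huv.2.2 _ hq.2.2 huv.1 hq.1 h
  · obtain ⟨p, hp, hp0, hpr⟩ := parent hu hn
    obtain ⟨p', hp', hp0', hpr'⟩ := parent hpr hp0
    obtain ⟨p'', hp'', hp0'', hpr''⟩ := parent hpr' hp0'
    refine hP v u p p' p'' huv.1.symm hp.1 hp'.1 hp''.1 ?_ ?_ ?_ ?_ ?_ ?_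
    · intro h; exact hS _ huv.2.1 _ huv.2.2 _ hp.2.2 huv.1 h hp.1
    · intro h; have := lev _ _ huv.2.2 hp'.2.2 h; omega
    · intro h; have := lev _ _ huv.2.2 hp''.2.2 h; omega
    · intro h; have := lev _ _ huv.2.1 hp'.2.2 h; omega
    · intro h; have := lev _ _ huv.2.1 hp''.2.2 h; omega
    · intro h; have := lev _ _ hp.2.2 hp''.2.2 h; omega
end PH

namespace PH
universe u
variable {V : Type u} {G : SimpleGraph V}

lemma all_att (hP : P5f G) {S : Set V} (hS : TFr G S) {a b c d e : V} (h : C5 G a b c d e)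
    (ha : a ∈ S) (hb : b ∈ S) (hc : c ∈ S) (hd : d ∈ S) (he : e ∈ S) {x : V}
    (hx : (Rg G S).Reachable a x) :
    (G.Adj x a ∨ G.Adj x b ∨ G.Adj x c ∨ G.Adj x d ∨ G.Adj x e) := by
  refine reach_const (H := Rg G S)
    (P := fun x => (G.Adj x a ∨ G.Adj x b ∨ G.Adj x c ∨ G.Adj x d ∨ G.Adj x e)) ?_ hx
    (Or.inr (Or.inl h.ab))
  intro y z hyz hy
  by_contra hz
  push Not at hz
  obtain ⟨z1, z2, z3, z4, z5⟩ := hz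
  have hzy := hyz.1.symm
  rcases C5.pat hP hS h ha hb hc hd he hyz.2.1 with k | k | k | k | k | k
  · tauto
  · exact hP z y b c d hzy k.2.1 h.bc h.cd z2 z3 z4 k.2.2.1 k.2.2.2.1 h.bd
  · exact hP z y c d e hzy k.2.2.1 h.cd h.de z3 z4 z5 k.2.2.2.1 k.2.2.2.2 h.ce
  · exact hP z y d e a hzy k.2.2.2.1 h.de h.ea z4 z5 z1 k.2.2.2.2 k.1 (fun q => h.ad q.symm)
  · exact hP z y e a b hzy k.2.2.2.2 h.ea h.ab z5 z1 z2 k.1 k.2.1 (fun q => h.be q.symm)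
  · exact hP z y a b c hzy k.1 h.ab h.bc z1 z2 z3 k.2.1 k.2.2.1 h.ac

open Classical in
/-- coloring relative to a five-cycle -/
noncomputable def cyc (G : SimpleGraph V) (a b c d e x : V) : ℕ :=
  if G.Adj x b ∧ G.Adj x e then 0 else if G.Adj x a ∧ G.Adj x c then 1 else
  if G.Adj x b ∧ G.Adj x d then 0 else if G.Adj x c ∧ G.Adj x e then 1 else 2

/-- output of the per-component colouring -/
def TFgood (G : SimpleGraph V) (S : Set V) (r : V) (g : V → ℕ) : Prop :=
  (∀ v, g v < 3) ∧
  (∀ u v, (Rg G S).Reachable r u → (Rg G S).Adj u v → g u ≠ g v) ∧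
  (∀ e, (∀ s ∈ S, ∀ t ∈ S, G.Adj e s → G.Adj e t → ¬ G.Adj s t) →
    ∀ s ∈ S, (Rg G S).Reachable r s → G.Adj e s → g s = 2 →
      (∀ t ∈ S, G.Adj e t → (Rg G S).Reachable r t) ∧
      ∃ c < 2, ∀ t ∈ S, G.Adj e t → g t ≠ c) ∧
  (¬ HasC5 G S → ∀ v, g v < 2)

set_option maxHeartbeats 1000000 in
lemma TFcomp (hP : P5f G) {S : Set V} (hS : TFr G S) {r : V} (hr : r ∈ S) :
    ∃ g : V → ℕ, TFgood G S r g := by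
  by_cases hno : ∃ a b c d e, C5 G a b c d e ∧ b ∈ S ∧ c ∈ S ∧ d ∈ S ∧ e ∈ S ∧ a ∈ S ∧
      (Rg G S).Reachable r a
  swap
  · refine ⟨fun v => (Rg G S).dist r v % 2, fun v => by dsimp; omega,
      fun u v hu huv => par_proper hP hS hr hno hu huv, ?_, fun _ v => by dsimp; omega⟩
    intro e _ s _ _ _ h2
    dsimp at h2; omega
  obtain ⟨a, b, c, d, e, h, hb, hc, hd, he, ha, hra⟩ := hno
  have tot : ∀ x, (Rg G S).Reachable r x → 
    (¬ G.Adj x a ∧ G.Adj x b ∧ ¬ G.Adj x c ∧ ¬ G.Adj x d ∧ G.Adj x e) ∨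
    (G.Adj x a ∧ ¬ G.Adj x b ∧ G.Adj x c ∧ ¬ G.Adj x d ∧ ¬ G.Adj x e) ∨
    (¬ G.Adj x a ∧ G.Adj x b ∧ ¬ G.Adj x c ∧ G.Adj x d ∧ ¬ G.Adj x e) ∨
    (¬ G.Adj x a ∧ ¬ G.Adj x b ∧ G.Adj x c ∧ ¬ G.Adj x d ∧ G.Adj x e) ∨
    (G.Adj x a ∧ ¬ G.Adj x b ∧ ¬ G.Adj x c ∧ G.Adj x d ∧ ¬ G.Adj x e) := by
    intro x hx
    have h1 := C5.pat hP hS h ha hb hc hd he (reach_mem hx hr)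
    have h2 := all_att hP hS h ha hb hc hd he (hra.symm.trans hx)
    rcases h1 with ⟨k1, k2, k3, k4, k5⟩ | h1
    · rcases h2 with k | k | k | k | k
      · exact absurd k k1
      · exact absurd k k2
      · exact absurd k k3
      · exact absurd k k4
      · exact absurd k k5
    · exact h1
  -- consecutive positions are complete to each other
  refine ⟨cyc G a b c d e, ?_, ?_, ?_, ?_⟩
  · intro v; unfold cyc; split_ifs <;> omega
  · intro u v hu huv
    have h1 := tot u hu
    have h2 := tot v (hu.trans huv.reachable)
    have n1 : ¬ (G.Adj u a ∧ G.Adj v a) := fun k => hS _ huv.2.1 _ huv.2.2 _ ha huv.1 k.2 k.1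
    have n2 : ¬ (G.Adj u b ∧ G.Adj v b) := fun k => hS _ huv.2.1 _ huv.2.2 _ hb huv.1 k.2 k.1
    have n3 : ¬ (G.Adj u c ∧ G.Adj v c) := fun k => hS _ huv.2.1 _ huv.2.2 _ hc huv.1 k.2 k.1
    have n4 : ¬ (G.Adj u d ∧ G.Adj v d) := fun k => hS _ huv.2.1 _ huv.2.2 _ hd huv.1 k.2 k.1
    have n5 : ¬ (G.Adj u e ∧ G.Adj v e) := fun k => hS _ huv.2.1 _ huv.2.2 _ he huv.1 k.2 k.1
    unfold cyc
    rcases h1 with k | k | k | k | k <;> rcases h2 with l | l | l | l | l <;> simp_all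
  · intro y hy s hs hrs hys hs2
    have hsp : G.Adj s a ∧ ¬ G.Adj s b ∧ ¬ G.Adj s c ∧ G.Adj s d ∧ ¬ G.Adj s e := by
      unfold cyc at hs2
      rcases tot s hrs with k | k | k | k | k <;> simp_all
    obtain ⟨sa, sb, sc, sd, se⟩ := hsp
    have ya : ¬ G.Adj y a := fun k => hy s hs a ha hys k sa
    have yd : ¬ G.Adj y d := fun k => hy s hs d hd hys k sd
    have ybc : G.Adj y b ∨ G.Adj y c := by
      by_contra hn
      push Not at hn
      exact hP y s a b c hys sa h.ab h.bc ya hn.1 hn.2 sb sc h.ac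
    have nbc : ¬ (G.Adj y b ∧ G.Adj y c) := fun k => hy b hb c hc k.1 k.2 h.bc
    have key : ∀ t ∈ S, G.Adj y t → (Rg G S).Reachable r t := by
      intro t ht hyt
      by_contra hnr
      have nt : ∀ z ∈ S, (Rg G S).Reachable r z → ¬ G.Adj t z := by
        intro z hz hrz k
        exact hnr (hrz.trans (SimpleGraph.Adj.reachable (G := Rg G S) ⟨k.symm, hz, ht⟩))
      have ra := hra
      have rb : (Rg G S).Reachable r b := ra.trans (SimpleGraph.Adj.reachable (G := Rg G S) ⟨h.ab, ha, hb⟩)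
      have rc : (Rg G S).Reachable r c := rb.trans (SimpleGraph.Adj.reachable (G := Rg G S) ⟨h.bc, hb, hc⟩)
      have rd : (Rg G S).Reachable r d := rc.trans (SimpleGraph.Adj.reachable (G := Rg G S) ⟨h.cd, hc, hd⟩)
      rcases ybc with k | k
      · exact hP t y s d c hyt.symm hys sd h.cd.symm (nt s hs hrs) (nt d hd rd) (nt c hc rc) yd
          (fun q => nbc ⟨k, q⟩) sc
      · exact hP t y s a b hyt.symm hys sa h.ab (nt s hs hrs) (nt a ha ra) (nt b hb rb) ya
          (fun q => nbc ⟨q, k⟩) sb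
    refine ⟨key, ?_⟩
    rcases ybc with k | k
    · have nyc : ¬ G.Adj y c := fun q => nbc ⟨k, q⟩
      -- t is not adjacent to b, and positions
      refine ⟨0, by omega, ?_⟩
      intro t ht hyt
      have tb : ¬ G.Adj t b := fun q => hy t ht b hb hyt k q
      unfold cyc
      split_ifs <;> simp_all
    · have nyb : ¬ G.Adj y b := fun q => nbc ⟨q, k⟩
      refine ⟨1, by omega, ?_⟩
      intro t ht hyt
      have tc : ¬ G.Adj t c := fun q => hy t ht c hc hyt k q
      unfold cyc
      split_ifs <;> simp_all
  · intro hC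
    exact absurd ⟨a, ha, b, hb, c, hc, d, hd, e, he, h⟩ hC

/-- colouring of triangle-free sets -/
lemma TF (hP : P5f G) {S : Set V} (hS : TFr G S) :
    ∃ f : V → ℕ, (∀ v, f v < 3) ∧ (∀ u ∈ S, ∀ v ∈ S, G.Adj u v → f u ≠ f v) ∧
      (∀ e, (∀ s ∈ S, ∀ t ∈ S, G.Adj e s → G.Adj e t → ¬ G.Adj s t) →
        ∃ c < 3, ∀ t ∈ S, G.Adj e t → f t ≠ c) ∧ (¬ HasC5 G S → ∀ v, f v < 2) := by
  classical
  have hex : ∀ r : V, ∃ g : V → ℕ, (r ∈ S → TFgood G S r g) ∧ (r ∉ S → ∀ v, g v < 2) := by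
    intro r
    by_cases hr : r ∈ S
    · obtain ⟨g, hg⟩ := TFcomp hP hS hr
      exact ⟨g, fun _ => hg, fun h => absurd hr h⟩
    · exact ⟨fun _ => 0, fun h => absurd h hr, fun _ _ => by simp⟩
  choose g hg using hex
  let rep : V → V := fun v => ((Rg G S).connectedComponentMk v).out
  have hrep : ∀ v, (Rg G S).Reachable (rep v) v := by
    intro v
    exact ConnectedComponent.exact (Quot.out_eq _)
  have hrepeq : ∀ u v, (Rg G S).Reachable u v → rep u = rep v := by
    intro u v h
    have : (Rg G S).connectedComponentMk u = (Rg G S).connectedComponentMk v :=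
      ConnectedComponent.sound h
    simp only [rep, this]
  have hrepS : ∀ v ∈ S, rep v ∈ S := fun v hv => reach_mem (hrep v).symm hv
  refine ⟨fun v => g (rep v) v, ?_, ?_, ?_, ?_⟩
  · intro v
    dsimp
    by_cases h : rep v ∈ S
    · exact ((hg _).1 h).1 v
    · have := (hg _).2 h v; omega
  · intro u hu v hv huv
    have hadj : (Rg G S).Adj u v := ⟨huv, hu, hv⟩
    dsimp
    rw [← hrepeq u v hadj.reachable]
    exact ((hg _).1 (hrepS u hu)).2.1 u v (hrep u) hadj
  · intro e he
    by_cases h2 : ∃ s ∈ S, G.Adj e s ∧ g (rep s) s = 2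
    · obtain ⟨s, hs, hes, hs2⟩ := h2
      obtain ⟨k1, c, hc, k2⟩ := ((hg _).1 (hrepS s hs)).2.2.1 e he s hs (hrep s) hes hs2
      refine ⟨c, by omega, ?_⟩
      intro t ht het
      have : rep t = rep s := hrepeq _ _ ((k1 t ht het).symm.trans (hrep s))
      dsimp
      rw [this]
      exact k2 t ht het
    · push Not at h2
      exact ⟨2, by omega, fun t ht het => h2 t ht het⟩
  · intro hC v
    dsimp
    by_cases h : rep v ∈ S
    · exact ((hg _).1 h).2.2.2 hC v
    · exact (hg _).2 h v
end PH

namespace PH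
universe u
variable {V : Type u} {G : SimpleGraph V}

lemma colorable_of_nat {n : ℕ} (f : V → ℕ) (hf : ∀ v, f v < n)
    (hp : ∀ u v, G.Adj u v → f u ≠ f v) : G.Colorable n :=
  ⟨Coloring.mk (fun v => (⟨f v, hf v⟩ : Fin n)) (fun {u v} h => by
    intro he
    exact hp u v h (congrArg Fin.val he))⟩

/-- the set of non-neighbours different from x -/
def Nn (G : SimpleGraph V) (x : V) : Set V := {v | v ≠ x ∧ ¬ G.Adj x v}

lemma sees (hP : P5f G) (hK : K4f G) {x y t1 t2 t3 e0 : V} (hxy : G.Adj x y)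
    (h1 : t1 ∈ Nn G x) (h2 : t2 ∈ Nn G x) (h3 : t3 ∈ Nn G x) (h12 : G.Adj t1 t2)
    (h23 : G.Adj t2 t3) (h13 : G.Adj t1 t3) (hy : G.Adj y e0)
    (hr : (Rg G (Nn G x)).Reachable t1 e0) : G.Adj y t1 ∨ G.Adj y t2 ∨ G.Adj y t3 := by
  by_contra hc
  push Not at hc
  obtain ⟨c1, c2, c3⟩ := hc
  let O' : Set V := {v | v ∈ Nn G x ∧ ¬ G.Adj y v}
  have m1 : t1 ∈ O' := ⟨h1, c1⟩
  have m2 : t2 ∈ O' := ⟨h2, c2⟩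
  have m3 : t3 ∈ O' := ⟨h3, c3⟩
  have hne : ¬ (Rg G O').Reachable t1 e0 := by
    intro h
    exact (reach_mem h m1).2 hy
  obtain ⟨a, b, -, hab, ha, hb⟩ := boundary (P := fun v => (Rg G O').Reachable t1 v) hr
    (Reachable.refl _) hne
  have haO := reach_mem ha m1
  have hyb : G.Adj y b := by
    by_contra hyb
    exact hb (ha.trans (SimpleGraph.Adj.reachable (G := Rg G O') ⟨hab.1, haO, hab.2.2, hyb⟩))
  have hcomp : ∀ z, (Rg G O').Reachable a z → G.Adj b z := by
    intro z hz
    refine reach_const (H := Rg G O') (P := fun v => G.Adj b v) ?_ hz hab.1.symm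
    intro e' e'' he hb'
    by_contra hb''
    exact hP e'' e' b y x he.1.symm hb'.symm hyb.symm hxy.symm (fun h => hb'' h.symm)
      (fun h => he.2.2.2 h.symm) (fun h => he.2.2.1.2 h.symm) (fun h => he.2.1.2 h.symm)
      (fun h => he.2.1.1.2 h.symm) (fun h => hab.2.2.2 h.symm)
  have r1 : (Rg G O').Reachable a t1 := ha.symm
  have r2 : (Rg G O').Reachable a t2 := r1.trans (SimpleGraph.Adj.reachable (G := Rg G O') ⟨h12, m1, m2⟩)
  have r3 : (Rg G O').Reachable a t3 := r1.trans (SimpleGraph.Adj.reachable (G := Rg G O') ⟨h13, m1, m3⟩)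
  exact hK b t1 t2 t3 (hcomp _ r1) (hcomp _ r2) (hcomp _ r3) h12 h13 h23

lemma sees' (hP : P5f G) (hK : K4f G) {x y t1 t2 t3 e0 : V} (hxy : G.Adj x y)
    (h1 : t1 ∈ Nn G x) (h2 : t2 ∈ Nn G x) (h3 : t3 ∈ Nn G x) (h12 : G.Adj t1 t2)
    (h23 : G.Adj t2 t3) (h13 : G.Adj t1 t3) (hy : G.Adj y e0)
    (hr : (Rg G (Nn G x)).Reachable t1 e0) :
    ∃ d d', G.Adj d d' ∧ G.Adj y d ∧ ¬ G.Adj y d' ∧ (Rg G (Nn G x)).Reachable t1 d ∧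
      (Rg G (Nn G x)).Reachable t1 d' ∧ (d = t1 ∨ d = t2 ∨ d = t3) ∧
      (d' = t1 ∨ d' = t2 ∨ d' = t3) := by
  have hs := sees hP hK hxy h1 h2 h3 h12 h23 h13 hy hr
  have hn : ¬ (G.Adj y t1 ∧ G.Adj y t2 ∧ G.Adj y t3) := fun h =>
    hK y t1 t2 t3 h.1 h.2.1 h.2.2 h12 h13 h23
  have r1 : (Rg G (Nn G x)).Reachable t1 t1 := Reachable.refl _
  have r2 : (Rg G (Nn G x)).Reachable t1 t2 :=
    SimpleGraph.Adj.reachable (G := Rg G (Nn G x)) ⟨h12, h1, h2⟩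
  have r3 : (Rg G (Nn G x)).Reachable t1 t3 :=
    SimpleGraph.Adj.reachable (G := Rg G (Nn G x)) ⟨h13, h1, h3⟩
  by_cases a1 : G.Adj y t1
  · by_cases a2 : G.Adj y t2
    · exact ⟨t1, t3, h13, a1, fun h => hn ⟨a1, a2, h⟩, r1, r3, by simp, by simp⟩
    · exact ⟨t1, t2, h12, a1, a2, r1, r2, by simp, by simp⟩
  · by_cases a2 : G.Adj y t2
    · exact ⟨t2, t1, h12.symm, a2, a1, r2, r1, by simp, by simp⟩
    · have a3 : G.Adj y t3 := by tauto
      exact ⟨t3, t1, h13.symm, a3, a1, r3, r1, by simp, by simp⟩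

lemma attach (hc : ∀ u v, G.Reachable u v) {x t : V} (ht : t ∈ Nn G x) :
    ∃ y h, G.Adj x y ∧ G.Adj y h ∧ (Rg G (Nn G x)).Reachable t h := by
  have hne : ¬ (Rg G (Nn G x)).Reachable t x := fun h => (reach_mem h ht).1 rfl
  obtain ⟨a, b, -, hab, ha, hb⟩ := boundary (P := fun v => (Rg G (Nn G x)).Reachable t v) (hc t x)
    (Reachable.refl _) hne
  have haO := reach_mem ha ht
  have hbx : b ≠ x := by
    rintro rfl
    exact haO.2 hab.symm
  refine ⟨b, a, ?_, hab.symm, ha⟩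
  by_contra hxb
  exact hb (ha.trans (SimpleGraph.Adj.reachable (G := Rg G (Nn G x)) ⟨hab, haO, hbx, hxb⟩))

lemma nbr_tf (hK : K4f G) (x : V) : TFr G {v | G.Adj x v} := by
  intro a ha b hb c hc h1 h2 h3
  exact hK x a b c ha hb hc h1 h3 h2

lemma Z0_tf (hP : P5f G) (hK : K4f G) (hc : ∀ u v, G.Reachable u v) {x y t1 t2 t3 h0 : V}
    (hxy : G.Adj x y)
    (h1 : t1 ∈ Nn G x) (h2 : t2 ∈ Nn G x) (h3 : t3 ∈ Nn G x) (h12 : G.Adj t1 t2)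
    (h23 : G.Adj t2 t3) (h13 : G.Adj t1 t3) (hy : G.Adj y h0)
    (hr : (Rg G (Nn G x)).Reachable t1 h0) : TFr G {v | ¬ G.Adj x v ∧ ¬ G.Adj y v} := by
  intro s1 hs1 s2 hs2 s3 hs3 e12 e23 e13
  have mem : ∀ s, (¬ G.Adj x s ∧ ¬ G.Adj y s) → s ∈ Nn G x := by
    intro s hs
    refine ⟨?_, hs.1⟩
    rintro rfl
    exact hs.2 hxy.symm
  have m1 := mem s1 hs1
  have m2 := mem s2 hs2
  have m3 := mem s3 hs3
  by_cases hyH : ∃ h, G.Adj y h ∧ (Rg G (Nn G x)).Reachable s1 h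
  · obtain ⟨h, hyh, hrh⟩ := hyH
    rcases sees hP hK hxy m1 m2 m3 e12 e23 e13 hyh hrh with k | k | k
    · exact hs1.2 k
    · exact hs2.2 k
    · exact hs3.2 k
  obtain ⟨z, h, hxz, hzh, hrh⟩ := attach hc m1
  obtain ⟨d, d', hdd, hzd, hzd', rd, rd', -, -⟩ := sees' hP hK hxz m1 m2 m3 e12 e23 e13 hzh hrh
  obtain ⟨c, c', hcc, hyc, hyc', rc, rc', -, -⟩ := sees' hP hK hxy h1 h2 h3 h12 h23 h13 hy hr
  have hsep : ∀ u v, (Rg G (Nn G x)).Reachable t1 u → (Rg G (Nn G x)).Reachable s1 v →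
      ¬ G.Adj u v := by
    intro u v hu hv huv
    apply hyH
    refine ⟨h0, hy, ?_⟩
    exact hv.trans ((SimpleGraph.Adj.reachable (G := Rg G (Nn G x))
      ⟨huv.symm, reach_mem hv m1, reach_mem hu h1⟩).trans (hu.symm.trans hr))
  have nx : ∀ u, (Rg G (Nn G x)).Reachable t1 u → ¬ G.Adj x u := fun u hu => (reach_mem hu h1).2
  by_cases hzH : ∃ h, G.Adj z h ∧ (Rg G (Nn G x)).Reachable t1 h
  · obtain ⟨h', hzh', hrh'⟩ := hzH
    obtain ⟨k, k', hkk, hzk, hzk', rk, rk', -, -⟩ := sees' hP hK hxz h1 h2 h3 h12 h23 h13 hzh' hrh'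
    exact hP k' k z d d' hkk.symm hzk.symm hzd hdd (fun q => hzk' q.symm) (hsep _ _ rk' rd)
      (hsep _ _ rk' rd') (hsep _ _ rk rd) (hsep _ _ rk rd') hzd'
  · push Not at hzH
    have zc : ¬ G.Adj z c := fun q => hzH c q rc
    have zc' : ¬ G.Adj z c' := fun q => hzH c' q rc'
    by_cases hyz : G.Adj y z
    · exact hP c' c y z d hcc.symm hyc.symm hyz hzd (fun q => hyc' q.symm) (fun q => zc' q.symm)
        (hsep _ _ rc' rd) (fun q => zc q.symm) (hsep _ _ rc rd) (fun q => hyH ⟨d, q, rd⟩)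
    · exact hP c' c y x z hcc.symm hyc.symm hxy.symm hxz (fun q => hyc' q.symm)
        (fun q => nx _ rc' q.symm) (fun q => zc' q.symm) (fun q => nx _ rc q.symm)
        (fun q => zc q.symm) hyz

open Classical in
lemma caseA (hP : P5f G) (hK : K4f G) (hc : ∀ u v, G.Reachable u v)
    (hA : ∀ w a b c d e, C5 G a b c d e → G.Adj w a → G.Adj w b → G.Adj w c → G.Adj w d →
      G.Adj w e → False) (x : V) : G.Colorable 6 := by
  have n5 : ∀ w, ¬ HasC5 G {v | G.Adj w v} := by
    rintro w ⟨a, ha, b, hb, c, hc, d, hd, e, he, h⟩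
    exact hA w a b c d e h ha hb hc hd he
  obtain ⟨f, f1, f2, -, f4⟩ := TF hP (nbr_tf hK x)
  replace f4 := f4 (n5 x)
  by_cases hS : TFr G {v | ¬ G.Adj x v}
  · obtain ⟨g, g1, g2, -, -⟩ := TF hP hS
    refine colorable_of_nat (fun v => if G.Adj x v then f v else 3 + g v) ?_ ?_
    · intro v; have := f1 v; have := g1 v; (try dsimp only); split_ifs <;> omega
    · intro u v huv
      have := f1 u; have := f1 v
      have A := f2 u; have B := g2 u
      (try dsimp only); split_ifs with k1 k2 k2
      · exact f2 u k1 v k2 huv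
      · omega
      · omega
      · have := g2 u k1 v k2 huv; omega
  unfold TFr at hS
  push Not at hS
  obtain ⟨t1, h1, t2, h2, t3, h3, h12, h23, h13, -⟩ := hS
  have mem : ∀ s t, ¬ G.Adj x s → ¬ G.Adj x t → G.Adj s t → s ∈ Nn G x := by
    intro s t hs ht hst
    refine ⟨?_, hs⟩
    rintro rfl
    exact ht hst
  have m1 := mem t1 t2 h1 h2 h12
  have m2 := mem t2 t3 h2 h3 h23
  have m3 := mem t3 t1 h3 h1 h13.symm
  obtain ⟨y, h0, hxy, hy, hr⟩ := attach hc m1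
  have hZ := Z0_tf hP hK hc hxy m1 m2 m3 h12 h23 h13 hy hr
  obtain ⟨g, g1, g2, -, g4⟩ := TF hP (nbr_tf hK y)
  replace g4 := g4 (n5 y)
  obtain ⟨z, z1, z2, -, z4⟩ := TF hP hZ
  by_cases hZ5 : HasC5 G {v | ¬ G.Adj x v ∧ ¬ G.Adj y v}
  swap
  · replace z4 := z4 hZ5
    refine colorable_of_nat (fun v => if G.Adj x v then f v else if G.Adj y v then 2 + g v
      else 4 + z v) ?_ ?_
    · intro v; have := f4 v; have := g4 v; have := z4 v; (try dsimp only); split_ifs <;> omega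
    · intro u v huv
      have := f4 u; have := f4 v; have := g4 u; have := g4 v; have := z4 u; have := z4 v
      (try dsimp only); split_ifs with k1 k2 k3 k2 k3 k3 k2 k3
      all_goals first
        | exact f2 u k1 v k2 huv
        | omega
        | (have := g2 u ‹_› v ‹_› huv; omega)
        | (have := z2 u ⟨k1, by assumption⟩ v ⟨by assumption, by assumption⟩ huv; omega)
  obtain ⟨a, ha, b, hb, c, hcc, d, hd, e, he, h⟩ := hZ5
  set Z : Set V := {v | ¬ G.Adj x v ∧ ¬ G.Adj y v} with hZdef
  have ra : (Rg G Z).Reachable a a := Reachable.refl _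
  have rb : (Rg G Z).Reachable a b := ra.trans (SimpleGraph.Adj.reachable (G := Rg G Z) ⟨h.ab, ha, hb⟩)
  have rc : (Rg G Z).Reachable a c := rb.trans (SimpleGraph.Adj.reachable (G := Rg G Z) ⟨h.bc, hb, hcc⟩)
  have rd : (Rg G Z).Reachable a d := rc.trans (SimpleGraph.Adj.reachable (G := Rg G Z) ⟨h.cd, hcc, hd⟩)
  have re : (Rg G Z).Reachable a e := rd.trans (SimpleGraph.Adj.reachable (G := Rg G Z) ⟨h.de, hd, he⟩)
  -- vertices not mixed on edges of Z are anticomplete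
  have anti : ∀ p, (∀ e e', (Rg G Z).Adj e e' → G.Adj p e → G.Adj p e') → ∀ m,
      (Rg G Z).Reachable a m → ¬ G.Adj p m := by
    intro p hp m hm hpm
    have all : ∀ n, (Rg G Z).Reachable a n → G.Adj p n := fun n hn =>
      reach_const (P := fun v => G.Adj p v) hp (hm.symm.trans hn) hpm
    exact hA p a b c d e h (all _ ra) (all _ rb) (all _ rc) (all _ rd) (all _ re)
  have antiP : ∀ p, G.Adj x p → ¬ G.Adj y p → ∀ m, (Rg G Z).Reachable a m → ¬ G.Adj p m := by
    intro p hp hyp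
    apply anti
    intro s s' hs hps
    by_contra hps'
    exact hP s' s p x y hs.1.symm hps.symm hp.symm hxy (fun q => hps' q.symm)
      (fun q => hs.2.2.1 q.symm) (fun q => hs.2.2.2 q.symm) (fun q => hs.2.1.1 q.symm)
      (fun q => hs.2.1.2 q.symm) (fun q => hyp q.symm)
  have antiQ : ∀ p, G.Adj y p → ¬ G.Adj x p → ∀ m, (Rg G Z).Reachable a m → ¬ G.Adj p m := by
    intro p hp hyp
    apply anti
    intro s s' hs hps
    by_contra hps'
    exact hP s' s p y x hs.1.symm hps.symm hp.symm hxy.symm (fun q => hps' q.symm)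
      (fun q => hs.2.2.2 q.symm) (fun q => hs.2.2.1 q.symm) (fun q => hs.2.1.2 q.symm)
      (fun q => hs.2.1.1 q.symm) (fun q => hyp q.symm)
  have hne : ¬ (Rg G Z).Reachable a x := fun k => (reach_mem k ha).2 hxy.symm
  obtain ⟨m, i, -, hmi, hm, hi⟩ := boundary (P := fun v => (Rg G Z).Reachable a v) (hc a x)
    (Reachable.refl _) hne
  have hmZ : m ∈ Z := reach_mem hm ha
  have hiZ : i ∉ Z := fun k => hi (hm.trans (SimpleGraph.Adj.reachable (G := Rg G Z) ⟨hmi, hmZ, k⟩))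
  have hxi : G.Adj x i := by
    by_contra k
    have : G.Adj y i := by
      by_contra k'
      exact hiZ ⟨k, k'⟩
    exact antiQ i this k m hm hmi.symm
  have hyi : G.Adj y i := by
    by_contra k
    exact antiP i hxi k m hm hmi.symm
  have hmix : ∃ s s', (Rg G Z).Adj s s' ∧ (Rg G Z).Reachable a s ∧ G.Adj i s ∧ ¬ G.Adj i s' := by
    by_contra hno
    push Not at hno
    have all : ∀ n, (Rg G Z).Reachable a n → G.Adj i n := fun n hn =>
      (reach_const (H := Rg G Z) (P := fun v => (Rg G Z).Reachable a v ∧ G.Adj i v)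
        (fun u v huv hu => ⟨hu.1.trans huv.reachable, hno u v huv hu.1 hu.2⟩)
        (hm.symm.trans hn) ⟨hm, hmi.symm⟩).2
    exact hA i a b c d e h (all _ ra) (all _ rb) (all _ rc) (all _ rd) (all _ re)
  obtain ⟨s, s', hss, hrs, his, his'⟩ := hmix
  have hrs' := hrs.trans hss.reachable
  have Pi : ∀ p, G.Adj x p → ¬ G.Adj y p → G.Adj i p := by
    intro p hp hyp
    by_contra hip
    exact hP s' s i x p hss.1.symm his.symm hxi.symm hp (fun q => his' q.symm)
      (fun q => hss.2.2.1 q.symm) (fun q => antiP p hp hyp _ hrs' q.symm)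
      (fun q => hss.2.1.1 q.symm) (fun q => antiP p hp hyp _ hrs q.symm) hip
  have Qi : ∀ p, G.Adj y p → ¬ G.Adj x p → G.Adj i p := by
    intro p hp hyp
    by_contra hip
    exact hP s' s i y p hss.1.symm his.symm hyi.symm hp (fun q => his' q.symm)
      (fun q => hss.2.2.2 q.symm) (fun q => antiQ p hp hyp _ hrs' q.symm)
      (fun q => hss.2.1.2 q.symm) (fun q => antiQ p hp hyp _ hrs q.symm) hip
  refine colorable_of_nat (fun v => if G.Adj x v then (if G.Adj y v then 0 else 1)
    else if G.Adj y v then 2 else 3 + z v) ?_ ?_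
  · intro v; have := z1 v; (try dsimp only); split_ifs <;> omega
  · intro u v huv
    try dsimp only
    by_cases xu : G.Adj x u <;> by_cases yu : G.Adj y u <;> by_cases xv : G.Adj x v <;>
      by_cases yv : G.Adj y v <;> simp only [xu, yu, xv, yv, if_true, if_false] <;>
      first
        | omega
        | (exact (hK x y u v hxy xu xv yu yv huv).elim)
        | (exact (hK x i u v hxi xu xv (Pi u xu yu) (Pi v xv yv) huv).elim)
        | (exact (hK y i u v hyi yu yv (Qi u yu xu) (Qi v yv xv) huv).elim)
        | (have := z2 u ⟨xu, yu⟩ v ⟨xv, yv⟩ huv; omega)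
end PH

namespace PH
universe u

/-- numeric code of a type -/
def tcode (A : Fin 5 → Bool) : ℕ :=
  (A 0).toNat + 2 * (A 1).toNat + 4 * (A 2).toNat + 8 * (A 3).toNat + 16 * (A 4).toNat

/-- type D_i -/
def tD (i : Fin 5) : Fin 5 → Bool := fun j => (j == i + 1) || (j == i + 4)
/-- type T_i -/
def tT (i : Fin 5) : Fin 5 → Bool := fun j => (j == i + 1) || (j == i + 4) || (j == i)
/-- type Y_i -/
def tY (i : Fin 5) : Fin 5 → Bool := fun j => (j == i + 2) || (j == i + 3) || (j == i)
/-- type F_i -/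
def tF (i : Fin 5) : Fin 5 → Bool := fun j => !(j == i)
/-- type Z -/
def tZ : Fin 5 → Bool := fun _ => false

/-- base colour of a type -/
def tcol (A : Fin 5 → Bool) : ℕ :=
  if tcode A = tcode (tY 0) then 3 else if tcode A = tcode (tY 1) then 4 else
  if tcode A = tcode (tY 2) then 3 else if tcode A = tcode (tY 3) then 4 else
  if tcode A = tcode (tY 4) then 5 else
  if tcode A = tcode (tF 0) then 5 else if tcode A = tcode (tF 1) then 3 else
  if tcode A = tcode (tF 2) then 4 else if tcode A = tcode (tF 3) then 5 else
  if tcode A = tcode (tF 4) then 5 else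
  if tcode A = tcode (tT 0) then 4 else if tcode A = tcode (tT 1) then 5 else
  if tcode A = tcode (tT 2) then 5 else if tcode A = tcode (tT 3) then 3 else
  if tcode A = tcode (tT 4) then 3 else
  if tcode A = tcode (tD 0) then 4 else if tcode A = tcode (tD 1) then 3 else
  if tcode A = tcode (tD 2) then 4 else if tcode A = tcode (tD 3) then 3 else
  if tcode A = tcode (tD 4) then 3 else
  if tcode A = tcode tZ then 3 else 5

/-- first palette colour -/
def tp (A : Fin 5 → Bool) : ℕ :=
  if tcode A = tcode (tD 0) ∨ tcode A = tcode (tD 2) then 4 else 3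
/-- second palette colour -/
def tq (A : Fin 5 → Bool) : ℕ :=
  if tcode A = tcode (tD 4) ∨ tcode A = tcode tZ then 4 else 5

/-- attachment rule -/
def tval (A : Fin 5 → Bool) : Prop := ∀ i, A i = true →
  (A (i+1) = true ∨ A (i+2) = true ∨ A (i+3) = true) ∧
  (A (i+4) = true ∨ A (i+3) = true ∨ A (i+2) = true)

/-- edge rule -/
def tadj (A B : Fin 5 → Bool) : Prop := ∀ i,
  ¬ (A i = true ∧ A (i+1) = true ∧ B i = true ∧ B (i+1) = true) ∧
  (A i ≠ B i → (A (i+2) = true ∨ B (i+2) = true) ∧ (A (i+3) = true ∨ B (i+3) = true))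

/-- special types -/
def tspec (A : Fin 5 → Bool) : Prop := tcode A = tcode tZ ∨ ∃ i, tcode A = tcode (tD i)

instance (A) : Decidable (tval A) := by unfold tval; infer_instance
instance (A B) : Decidable (tadj A B) := by unfold tadj; infer_instance
instance (A) : Decidable (tspec A) := by unfold tspec; infer_instance

/-- avoiding the palette -/
def tav (A B : Fin 5 → Bool) : Prop := tcol B ≠ tp A ∧ tcol B ≠ tq A
instance (A B) : Decidable (tav A B) := by unfold tav; infer_instance
/-- check for the D types -/
def tchD (A B : Fin 5 → Bool) (i : Fin 5) : Prop :=
  tcode A = tcode (tD i) ∧ tcode B ≠ tcode A → B i = true ∧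
    (B (i+1) = false ∧ B (i+4) = false → tav A B)
instance (A B i) : Decidable (tchD A B i) := by unfold tchD; infer_instance
/-- conclusions of the master check -/
def tcon (A B : Fin 5 → Bool) : Prop :=
  (tcol A ≠ tcol B ∨ (tcode A = tcode B ∧ tspec A)) ∧ (tspec A ∧ tspec B → tcode A = tcode B) ∧
  (tcode A = tcode tZ ∧ tcode B ≠ tcode A → tav A B) ∧ (∀ i, tchD A B i)
instance (A B) : Decidable (tcon A B) := by unfold tcon; infer_instance
/-- the master check -/
def tchk (A B : Fin 5 → Bool) : Prop := tval A ∧ tval B ∧ tadj A B → tcon A B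
instance (A B) : Decidable (tchk A B) := by unfold tchk; infer_instance

set_option maxRecDepth 100000 in
lemma tchk_all5 : ∀ a0 a1 a2 a3 a4 b0 b1 b2 b3 b4 : Bool,
    tchk ![a0, a1, a2, a3, a4] ![b0, b1, b2, b3, b4] := by
  decide +kernel

lemma vec5 (A : Fin 5 → Bool) : A = ![A 0, A 1, A 2, A 3, A 4] := by
  funext i; fin_cases i <;> rfl

lemma tchk_all (A B : Fin 5 → Bool) : tchk A B := by
  rw [vec5 A, vec5 B]; exact tchk_all5 _ _ _ _ _ _ _ _ _ _

lemma tcode_inj {A B : Fin 5 → Bool} (h : tcode A = tcode B) : A = B := by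
  have : ∀ a0 a1 a2 a3 a4 b0 b1 b2 b3 b4 : Bool,
    tcode ![a0, a1, a2, a3, a4] = tcode ![b0, b1, b2, b3, b4] →
      a0 = b0 ∧ a1 = b1 ∧ a2 = b2 ∧ a3 = b3 ∧ a4 = b4 := by decide +kernel
  rw [vec5 A, vec5 B] at h
  have := this _ _ _ _ _ _ _ _ _ _ h
  rw [vec5 A, vec5 B]
  simp [this]

lemma tspec_gap {A : Fin 5 → Bool} (h : tspec A) : ∃ j, A j = false ∧ A (j+1) = false := by
  rcases h with h | ⟨i, h⟩
  · rw [tcode_inj h]; exact ⟨0, rfl, rfl⟩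
  · rw [tcode_inj h]
    clear h; revert i; decide +kernel

lemma tcol_bd (A : Fin 5 → Bool) : 3 ≤ tcol A ∧ tcol A < 6 := by
  have : ∀ a0 a1 a2 a3 a4 : Bool,
    3 ≤ tcol ![a0, a1, a2, a3, a4] ∧ tcol ![a0, a1, a2, a3, a4] < 6 := by decide +kernel
  rw [vec5 A]; exact this _ _ _ _ _
lemma tpq_bd (A : Fin 5 → Bool) (h : tspec A) : 3 ≤ tp A ∧ tp A < 6 ∧ 3 ≤ tq A ∧ tq A < 6 ∧ tp A ≠ tq A := by
  rcases h with h | ⟨i, h⟩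
  · rw [tcode_inj h]; decide +kernel
  · rw [tcode_inj h]
    clear h; revert i; decide +kernel

lemma tD_facts (i : Fin 5) : tD i i = false ∧ tD i (i+1) = true ∧ tD i (i+4) = true := by
  revert i; decide +kernel
end PH

namespace PH
universe u
variable {V : Type u} {G : SimpleGraph V}

open Classical in
/-- type of a vertex with respect to a cycle -/
noncomputable def ty (G : SimpleGraph V) (v : Fin 5 → V) (h : V) : Fin 5 → Bool :=
  fun i => decide (G.Adj h (v i))

lemma ty_true {v : Fin 5 → V} {h : V} {i : Fin 5} : ty G v h i = true ↔ G.Adj h (v i) := by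
  simp [ty]
lemma ty_false {v : Fin 5 → V} {h : V} {i : Fin 5} : ty G v h i = false ↔ ¬ G.Adj h (v i) := by
  simp [ty]

section
variable {v : Fin 5 → V} {w : V} (hP : P5f G) (hK : K4f G)
  (hC : ∀ i, C5 G (v i) (v (i+1)) (v (i+2)) (v (i+3)) (v (i+4))) (hw : ∀ i, G.Adj w (v i))

include hP hC in
lemma ty_val (h : V) : tval (ty G v h) := by
  intro i
  simp only [ty_true]
  intro hi
  refine ⟨C5.att hP (hC i) hi, C5.att hP (hC i).refl hi⟩

include hP hC hw in
lemma ty_r2 {h k : V} (hh : h ∈ Nn G w) (hk : k ∈ Nn G w) (hhk : G.Adj h k) (i : Fin 5)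
    (h1 : G.Adj h (v i)) (h2 : ¬ G.Adj k (v i)) :
    (G.Adj h (v (i+2)) ∨ G.Adj k (v (i+2))) ∧ (G.Adj h (v (i+3)) ∨ G.Adj k (v (i+3))) := by
  constructor
  · by_contra hc
    push Not at hc
    exact hP k h (v i) w (v (i+2)) hhk.symm h1 (hw i).symm (hw _) h2 (fun q => hk.2 q.symm) hc.2
      (fun q => hh.2 q.symm) hc.1 (hC i).ac
  · by_contra hc
    push Not at hc
    exact hP k h (v i) w (v (i+3)) hhk.symm h1 (hw i).symm (hw _) h2 (fun q => hk.2 q.symm) hc.2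
      (fun q => hh.2 q.symm) hc.1 (hC i).ad

include hP hK hC hw in
lemma ty_adj {h k : V} (hh : h ∈ Nn G w) (hk : k ∈ Nn G w) (hhk : G.Adj h k) :
    tadj (ty G v h) (ty G v k) := by
  intro i
  refine ⟨?_, ?_⟩
  · simp only [ty_true]
    rintro ⟨a, b, c, d⟩
    exact hK h k (v i) (v (i+1)) hhk a b c d (hC i).ab
  · intro hne
    simp only [ty_true]
    by_cases h1 : G.Adj h (v i)
    · by_cases h2 : G.Adj k (v i)
      · exact absurd ((ty_true.2 h1).trans (ty_true.2 h2).symm) hne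
      · exact ty_r2 hP hC hw hh hk hhk i h1 h2
    · by_cases h2 : G.Adj k (v i)
      · have := ty_r2 hP hC hw hk hh hhk.symm i h2 h1
        exact ⟨this.1.symm, this.2.symm⟩
      · exact absurd ((ty_false.2 h1).trans (ty_false.2 h2).symm) hne

include hP hK hC hw in
lemma n_notmix {h k n : V} (hh : h ∈ Nn G w) (hk : k ∈ Nn G w) (hhk : G.Adj h k)
    (hs : tspec (ty G v h)) (he : ty G v h = ty G v k) (hn : G.Adj w n) (hhn : G.Adj h n) :
    G.Adj k n := by
  obtain ⟨j, j1, j2⟩ := tspec_gap hs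
  have k1 := ty_false.1 (he ▸ j1)
  have k2 := ty_false.1 (he ▸ j2)
  rw [ty_false] at j1 j2
  by_contra hkn
  have key : ∀ i, ¬ G.Adj h (v i) → ¬ G.Adj k (v i) → G.Adj n (v i) := by
    intro i h1 h2
    by_contra h3
    exact hP k h n w (v i) hhk.symm hhn hn.symm (hw i) hkn (fun q => hk.2 q.symm) h2
      (fun q => hh.2 q.symm) h1 h3
  exact hK w n (v j) (v (j+1)) hn (hw _) (hw _) (key _ j1 k1) (key _ j2 k2) (hC j).ab

include hP hK hC hw in
lemma spec_tf (hc : ∀ u v, G.Reachable u v) {A : Fin 5 → Bool} (hA : tspec A) :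
    TFr G {h | h ∈ Nn G w ∧ ty G v h = A} := by
  rcases hA with hA | ⟨i, hA⟩
  · replace hA := tcode_inj hA
    subst hA
    have hz : ∀ h, ty G v h = tZ → ∀ i, ¬ G.Adj h (v i) := by
      intro h hh i
      rw [← ty_false, hh]; rfl
    rintro t1 ⟨m1, e1⟩ t2 ⟨m2, e2⟩ t3 ⟨m3, e3⟩ h12 h23 h13
    obtain ⟨y, h, hwy, hyh, hr⟩ := attach hc m1
    obtain ⟨d, d', hdd, hyd, hyd', -, -, hd, hd'⟩ := sees' hP hK hwy m1 m2 m3 h12 h23 h13 hyh hr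
    have md : d ∈ Nn G w ∧ ty G v d = tZ := by rcases hd with rfl | rfl | rfl <;> exact ⟨‹_›, ‹_›⟩
    have md' : d' ∈ Nn G w ∧ ty G v d' = tZ := by rcases hd' with rfl | rfl | rfl <;> exact ⟨‹_›, ‹_›⟩
    exact hyd' (n_notmix hP hK hC hw md.1 md'.1 hdd (by rw [md.2]; left; rfl) (by rw [md.2, md'.2])
      hwy hyd.symm).symm
  · replace hA := tcode_inj hA
    subst hA
    intro a ha b hb c hc' h1 h2 h3
    have key : ∀ h, ty G v h = tD i → G.Adj (v (i+1)) h := by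
      intro h hh
      refine SimpleGraph.Adj.symm ?_
      rw [← ty_true, hh]; exact (tD_facts i).2.1
    exact hK (v (i+1)) a b c (key a ha.2) (key b hb.2) (key c hc'.2) h1 h3 h2

include hP hK hC hw in
lemma other_av {h k m : V} (hh : h ∈ Nn G w) (hk : k ∈ Nn G w) (hm : m ∈ Nn G w)
    (hhk : G.Adj h k) (hs : tspec (ty G v h)) (he : ty G v h = ty G v k) (hhm : G.Adj h m)
    (hne : ty G v m ≠ ty G v h) : tav (ty G v h) (ty G v m) := by
  have hchk := tchk_all (ty G v h) (ty G v m) ⟨ty_val hP hC h, ty_val hP hC m,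
    ty_adj hP hK hC hw hh hm hhm⟩
  have hne' : tcode (ty G v m) ≠ tcode (ty G v h) := fun q => hne (tcode_inj q)
  rcases hs with hs | ⟨i, hs⟩
  · exact hchk.2.2.1 ⟨hs, hne'⟩
  · obtain ⟨c1, c2⟩ := hchk.2.2.2 i ⟨hs, hne'⟩
    have hD := tcode_inj hs
    have hDk : ty G v k = tD i := he ▸ hD
    obtain ⟨d1, d2, d3⟩ := tD_facts i
    have mi := ty_true.1 c1
    have hkm : G.Adj k m := by
      by_contra hkm
      refine hP k h m (v i) w hhk.symm hhm mi (hw i).symm hkm ?_ (fun q => hk.2 q.symm) ?_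
        (fun q => hh.2 q.symm) (fun q => hm.2 q.symm)
      · rw [← ty_false, hDk]; exact d1
      · rw [← ty_false, hD]; exact d1
    have aux : ∀ j, tD i j = true → ty G v m j = false := by
      intro j hj
      rw [ty_false]
      intro q
      have q1 : G.Adj h (v j) := by rw [← ty_true, hD]; exact hj
      have q2 : G.Adj k (v j) := by rw [← ty_true, hDk]; exact hj
      exact hK h k m (v j) hhk hhm q1 hkm q2 q
    exact c2 ⟨aux _ d2, aux _ d3⟩

include hP hK hC hw in
open Classical in
lemma caseB0 (hc : ∀ u v, G.Reachable u v) : G.Colorable 6 := by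
  obtain ⟨f, f1, f2, f3, -⟩ := TF hP (nbr_tf hK w)
  have hg : ∀ A : Fin 5 → Bool, ∃ g : V → ℕ, (∀ v, g v < 3) ∧ (tspec A →
      ∀ h k, h ∈ Nn G w → k ∈ Nn G w → ty G v h = A → ty G v k = A → G.Adj h k → g h ≠ g k) := by
    intro A
    by_cases hA : tspec A
    · obtain ⟨g, g1, g2, -, -⟩ := TF hP (spec_tf hP hK hC hw hc hA)
      exact ⟨g, g1, fun _ h k hh hk eh ek hhk => g2 h ⟨hh, eh⟩ k ⟨hk, ek⟩ hhk⟩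
    · exact ⟨fun _ => 0, by simp, fun h => absurd h hA⟩
  choose g g1 g2 using hg
  -- choice of missing colours
  have hcc : ∀ X : Set V, ∃ c < 3, (∃ c < 3, ∀ t ∈ X, f t ≠ c) → ∀ t ∈ X, f t ≠ c := by
    intro X
    by_cases h : ∃ c < 3, ∀ t ∈ X, f t ≠ c
    · obtain ⟨c, h1, h2⟩ := h
      exact ⟨c, h1, fun _ => h2⟩
    · exact ⟨0, by omega, fun q => absurd q h⟩
  choose cc cc1 cc2 using hcc
  let NT : V → Prop := fun h => tspec (ty G v h) ∧
    ∃ k ∈ Nn G w, ty G v h = ty G v k ∧ G.Adj h k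
  let NS : V → Set V := fun h => {n | G.Adj w n ∧ G.Adj h n}
  let sc : V → ℕ := fun h => if g (ty G v h) h = 0 then tp (ty G v h) else
    if g (ty G v h) h = 1 then tq (ty G v h) else cc (NS h)
  let oc : V → ℕ := fun h => if NT h then sc h else tcol (ty G v h)
  let F : V → ℕ := fun h => if G.Adj w h then f h else if h = w then 3 else oc h
  have missing : ∀ h ∈ Nn G w, NT h → ∀ t, G.Adj w t → G.Adj h t → f t ≠ cc (NS h) := by
    rintro h hh ⟨hs, k, hk, he, hhk⟩ t hwt hht
    have hnm : ∀ n, G.Adj w n → G.Adj h n → G.Adj k n := fun n hn hhn =>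
      n_notmix hP hK hC hw hh hk hhk hs he hn hhn
    refine cc2 (NS h) ?_ t ⟨hwt, hht⟩
    obtain ⟨c, c1, c2⟩ := f3 h (by
      intro s hs t ht h1 h2 h3
      exact hK h k s t hhk h1 h2 (hnm s hs h1) (hnm t ht h2) h3)
    exact ⟨c, c1, fun t ht => c2 t ht.1 ht.2⟩
  have sc6 : ∀ h, NT h → sc h < 6 := by
    intro h hh
    have h1 := tpq_bd _ hh.1
    have h2 := cc1 (NS h)
    simp only [sc]; split_ifs <;> omega
  have ocn : ∀ h ∈ Nn G w, ∀ t, G.Adj w t → G.Adj h t → f t ≠ oc h := by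
    intro h hh t hwt hht
    have := f1 t
    simp only [oc]
    split_ifs with hn
    · have h1 := tpq_bd _ hn.1
      have h2 := missing h hh hn t hwt hht
      simp only [sc]; split_ifs
      · omega
      · omega
      · exact h2
    · have := (tcol_bd (ty G v h)).1; omega
  -- nontrivial special versus other type
  have ocs : ∀ h ∈ Nn G w, ∀ k ∈ Nn G w, G.Adj h k → NT h → ¬ NT k → sc h ≠ tcol (ty G v k) := by
    intro h hh k hk hhk hn hnk
    have hne : ty G v k ≠ ty G v h := by
      intro q
      exact hnk ⟨q ▸ hn.1, h, hh, q, hhk.symm⟩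
    obtain ⟨hs, m, hm, he, hhm⟩ := hn
    have := other_av hP hK hC hw hh hm hk hhm hs he hhk hne
    have h1 := cc1 (NS h)
    have h2 := tcol_bd (ty G v k)
    have a1 := this.1
    have a2 := this.2
    simp only [sc]; split_ifs <;> omega
  have oco : ∀ h ∈ Nn G w, ∀ k ∈ Nn G w, G.Adj h k → oc h ≠ oc k := by
    intro h hh k hk hhk
    have hchk := tchk_all (ty G v h) (ty G v k) ⟨ty_val hP hC h, ty_val hP hC k,
      ty_adj hP hK hC hw hh hk hhk⟩
    simp only [oc]
    split_ifs with n1 n2 n2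
    · have he : ty G v h = ty G v k := tcode_inj (hchk.2.1 ⟨n1.1, n2.1⟩)
      have hNS : NS h = NS k := by
        ext n
        constructor
        · rintro ⟨a, b⟩; exact ⟨a, n_notmix hP hK hC hw hh hk hhk n1.1 he a b⟩
        · rintro ⟨a, b⟩; exact ⟨a, n_notmix hP hK hC hw hk hh hhk.symm n2.1 he.symm a b⟩
      have gne := g2 (ty G v h) n1.1 h k hh hk rfl he.symm hhk
      have b1 := g1 (ty G v h) h
      have b2 := g1 (ty G v h) k
      have h1 := tpq_bd _ n1.1
      have h2 := cc1 (NS k)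
      simp only [sc]
      rw [← he, hNS]
      split_ifs <;> omega
    · exact ocs h hh k hk hhk n1 n2
    · exact (ocs k hk h hh hhk.symm n2 n1).symm
    · rcases hchk.1 with q | ⟨q1, q2⟩
      · exact q
      · exact absurd ⟨q2, k, hk, tcode_inj q1, hhk⟩ n1
  refine colorable_of_nat F ?_ ?_
  · intro h
    simp only [F, oc]
    split_ifs with q1 q2 q3
    · have := f1 h; omega
    · omega
    · exact sc6 h q3
    · exact (tcol_bd _).2
  · intro a b hab
    have fa := f1 a
    have fb := f1 b
    simp only [F]
    split_ifs with q1 q2 q3 q4 q5 q6 q7 q8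
    · exact f2 a q1 b q2 hab
    · omega
    · exact ocn b ⟨q3, q2⟩ a q1 hab.symm
    · omega
    · subst q4; subst q6; exact absurd hab (G.loopless.irrefl _)
    · subst q4; exact absurd hab q5
    · exact (ocn a ⟨q4, q1⟩ b q7 hab).symm
    · subst q8; exact absurd hab.symm q1
    · exact oco a ⟨q4, q1⟩ b ⟨q8, q7⟩ hab
end

lemma partI (hP : P5f G) (hK : K4f G) (hc : ∀ u v, G.Reachable u v) : G.Colorable 6 := by
  by_cases hA : ∀ w a b c d e, C5 G a b c d e → G.Adj w a → G.Adj w b → G.Adj w c → G.Adj w d →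
      G.Adj w e → False
  · by_cases hV : Nonempty V
    · exact caseA hP hK hc hA hV.some
    · rw [not_nonempty_iff] at hV
      exact colorable_of_nat (fun _ => 0) (fun _ => by omega) (fun u => hV.elim u)
  · push Not at hA
    obtain ⟨w, a, b, c, d, e, h, ha, hb, hcc, hd, he, -⟩ := hA
    refine caseB0 (v := ![a, b, c, d, e]) (w := w) hP hK ?_ ?_ hc
    · intro i
      fin_cases i
      · exact h
      · exact h.rot
      · exact h.rot.rot
      · exact h.rot.rot.rot
      · exact h.rot.rot.rot.rot
    · intro i
      fin_cases i <;> assumption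
end PH

namespace PH
universe u
variable {V : Type u} {G : SimpleGraph V}

/-- a sequence of pairwise adjacent vertices -/
def Clq (G : SimpleGraph V) {n : ℕ} (c : Fin n → V) : Prop := ∀ i j, i ≠ j → G.Adj (c i) (c j)

lemma Clq.cons {n : ℕ} {c : Fin n → V} (hc : Clq G c) {v : V} (hv : ∀ i, G.Adj v (c i)) :
    Clq G (Fin.cons v c : Fin (n+1) → V) := by
  intro i j
  induction i using Fin.cases with
  | zero =>
    induction j using Fin.cases with
    | zero => intro h; exact absurd rfl h
    | succ j => intro _; simpa using hv j
  | succ i =>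
    induction j using Fin.cases with
    | zero => intro _; simpa using (hv i).symm
    | succ j => intro h; simpa using hc i j (fun e => h (by rw [e]))

lemma avoid {k : ℕ} (hk : 4 ≤ k) (p q r : Fin k) : ∃ l, l ≠ p ∧ l ≠ q ∧ l ≠ r := by
  classical
  have : (({p, q, r} : Finset (Fin k))ᶜ).Nonempty := by
    rw [← Finset.card_pos, Finset.card_compl, Fintype.card_fin]
    have := Finset.card_le_three (a := p) (b := q) (c := r)
    omega
  obtain ⟨l, hl⟩ := this
  simp at hl
  exact ⟨l, hl⟩

/-- the i-th part of the block of c -/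
def Pt (G : SimpleGraph V) {k : ℕ} (c : Fin k → V) (i : Fin k) (v : V) : Prop :=
  ∀ j, j ≠ i → G.Adj v (c j)

/-- the block -/
def Bl (G : SimpleGraph V) {k : ℕ} (c : Fin k → V) : Set V := {v | ∃ i, Pt G c i v}

section
variable {k : ℕ} (hP : P5f G) (hH : HVNf G) (hk : 4 ≤ k)
  (hF : ∀ c : Fin (k+1) → V, ¬ Clq G c) {c : Fin k → V} (hc : Clq G c)

lemma Clq.upd {L : Fin k → V} (hL : Clq G L) {m : Fin k} {v : V}
    (hv : ∀ n, n ≠ m → G.Adj v (L n)) : Clq G (Function.update L m v) := by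
  intro i j hij
  by_cases h1 : i = m
  · subst h1
    rw [Function.update_self, Function.update_of_ne hij.symm]
    exact hv j hij.symm
  · by_cases h2 : j = m
    · subst h2
      rw [Function.update_self, Function.update_of_ne hij]
      exact (hv i hij).symm
    · rw [Function.update_of_ne h1, Function.update_of_ne h2]
      exact hL i j hij

include hc in
lemma pt_self (i : Fin k) : Pt G c i (c i) := fun j hj => hc i j hj.symm

include hF in
lemma no_dom {L : Fin k → V} (hL : Clq G L) {v : V} (hv : ∀ i, G.Adj v (L i)) : False :=
  hF _ (hL.cons hv)

include hF hc in
lemma pt_indep {i : Fin k} {u v : V} (hu : Pt G c i u) (hv : Pt G c i v) : ¬ G.Adj u v := by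
  intro huv
  refine no_dom hF (hc.upd hu) (v := v) ?_
  intro j
  by_cases h : j = i
  · subst h; rw [Function.update_self]; exact huv.symm
  · rw [Function.update_of_ne h]; exact hv j h

include hH hk hF hc in
lemma pt_comp {i j : Fin k} (hij : i ≠ j) {u v : V} (hu : Pt G c i u) (hv : Pt G c j v) :
    G.Adj u v := by
  by_contra huv
  obtain ⟨l, l1, l2, -⟩ := avoid hk i j j
  obtain ⟨m, m1, m2, m3⟩ := avoid hk i j l
  exact hH (c l) (c m) v (c i) u (hc _ _ m3.symm) (hv l l2).symm (hc _ _ l1) (hv m m2).symm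
    (hc _ _ m1) (hv i hij) (hu l l1) (hu m m1) huv (pt_indep hF hc hu (pt_self hc i))

include hH hk hF hc in
lemma tr_all {x : V} {t : Fin k → V} (ht : ∀ i, Pt G c i (t i)) {i j : Fin k} (hij : i ≠ j)
    (hi : G.Adj x (t i)) (hj : G.Adj x (t j)) : ∃ l, ∀ m, m ≠ l → G.Adj x (t m) := by
  have hT : Clq G t := fun p q hpq => pt_comp hH hk hF hc hpq (ht p) (ht q)
  by_contra hno
  push Not at hno
  obtain ⟨l, -, hl⟩ := hno i
  obtain ⟨m, hml, hm⟩ := hno l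
  have il : i ≠ l := by rintro rfl; exact hl hi
  have im : i ≠ m := by rintro rfl; exact hm hi
  have jl : j ≠ l := by rintro rfl; exact hl hj
  have jm : j ≠ m := by rintro rfl; exact hm hj
  exact hH (t i) (t j) (t l) (t m) x (hT _ _ hij) (hT _ _ il) (hT _ _ im) (hT _ _ jl) (hT _ _ jm)
    (hT _ _ hml.symm) hi hj hl hm

include hH hk hF hc in
lemma tr_step {x : V} {t t' : Fin k → V} (ht' : ∀ i, Pt G c i (t' i)) {p : Fin k}
    (hp : ∀ m, m ≠ p → t' m = t m) (h : ∃ l, ∀ m, m ≠ l → G.Adj x (t m)) :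
    ∃ l, ∀ m, m ≠ l → G.Adj x (t' m) := by
  obtain ⟨l, hl⟩ := h
  obtain ⟨a, a1, a2, -⟩ := avoid hk p l l
  obtain ⟨b, b1, b2, b3⟩ := avoid hk p l a
  exact tr_all hH hk hF hc ht' b3.symm (by rw [hp a a1]; exact hl a a2)
    (by rw [hp b b1]; exact hl b b2)

include hH hk hF hc in
lemma bl_two {x : V} {i j : Fin k} (hij : i ≠ j) {u v : V} (hu : Pt G c i u) (hv : Pt G c j v)
    (hxu : G.Adj x u) (hxv : G.Adj x v) : x ∈ Bl G c := by
  have pu : ∀ (t : Fin k → V) (i : Fin k) (u : V), Pt G c i u → (∀ m, Pt G c m (t m)) →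
      ∀ m, Pt G c m (Function.update t i u m) := by
    intro t i u hu ht m
    by_cases h : m = i
    · subst h; rw [Function.update_self]; exact hu
    · rw [Function.update_of_ne h]; exact ht m
  have h0 : ∀ m, Pt G c m (c m) := pt_self hc
  have h1 := pu c i u hu h0
  have h2 := pu _ j v hv h1
  have s2 := tr_all hH hk hF hc (x := x) h2 hij
    (by rw [Function.update_of_ne hij, Function.update_self]; exact hxu)
    (by rw [Function.update_self]; exact hxv)
  have s1 := tr_step hH hk hF hc h1 (p := j) (fun m hm => by rw [Function.update_of_ne hm]) s2
  exact tr_step hH hk hF hc h0 (p := i) (fun m hm => by rw [Function.update_of_ne hm]) s1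

include hF hc in
lemma pt_ne {i j : Fin k} {u v : V} (hu : Pt G c i u) (hv : Pt G c j v) (huv : G.Adj u v) :
    i ≠ j := by
  rintro rfl
  exact pt_indep hF hc hu hv huv

include hH hk hF hc in
lemma bl_two' {x u v : V} (hu : u ∈ Bl G c) (hv : v ∈ Bl G c) (huv : G.Adj u v)
    (hxu : G.Adj x u) (hxv : G.Adj x v) : x ∈ Bl G c := by
  obtain ⟨i, hi⟩ := hu
  obtain ⟨j, hj⟩ := hv
  exact bl_two hH hk hF hc (pt_ne hF hc hi hj huv) hi hj hxu hxv

include hH hk hF hc in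
lemma bl_sub {d : Fin k → V} (hd : Clq G d) {u v : V} (huv : G.Adj u v) (hu : u ∈ Bl G c)
    (hv : v ∈ Bl G c) (hu' : u ∈ Bl G d) (hv' : v ∈ Bl G d) : Bl G d ⊆ Bl G c := by
  obtain ⟨p, hp⟩ := hu'
  obtain ⟨q, hq⟩ := hv'
  have hpq := pt_ne hF hd hp hq huv
  rintro x ⟨l, hl⟩
  obtain ⟨m, m1, m2, m3⟩ := avoid hk p q l
  have dm := pt_self hd m
  have am := pt_comp hH hk hF hd m1 dm hp
  have bm := pt_comp hH hk hF hd m2 dm hq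
  have cm := pt_comp hH hk hF hd m3 dm hl
  have hm : d m ∈ Bl G c := bl_two' hH hk hF hc hu hv huv am bm
  by_cases h1 : l = p
  · subst h1
    exact bl_two' hH hk hF hc hv hm bm.symm (pt_comp hH hk hF hd hpq hl hq) cm.symm
  · exact bl_two' hH hk hF hc hu hm am.symm (pt_comp hH hk hF hd h1 hl hp) cm.symm

include hF hc in
lemma bl_hit {L : Fin k → V} (hL : Clq G L) (hB : ∀ m, L m ∈ Bl G c) (i : Fin k) :
    ∃ m, Pt G c i (L m) := by
  choose φ hφ using hB
  have hinj : Function.Injective φ := by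
    intro m n hmn
    by_contra hne
    exact pt_ne hF hc (hφ m) (hφ n) (hL m n hne) hmn
  obtain ⟨m, hm⟩ := (Finite.injective_iff_surjective.1 hinj) i
  exact ⟨m, hm ▸ hφ m⟩

include hH hk hF in
lemma pure_case (hpure : ∀ c : Fin k → V, Clq G c → ∃ i, ∀ a, Pt G c i a → ∀ x, G.Adj a x →
    x ∈ Bl G c) :
    ∃ I : Set V, (∀ u ∈ I, ∀ v ∈ I, ¬ G.Adj u v) ∧ ∀ L : Fin k → V, Clq G L → ∃ m, L m ∈ I := by
  classical
  have hsel : ∀ X : Set V, ∃ P : Set V, (∃ c : Fin k → V, Clq G c ∧ Bl G c = X) →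
      ∃ c : Fin k → V, Clq G c ∧ Bl G c = X ∧ ∃ i, P = {v | Pt G c i v} ∧
        ∀ a ∈ P, ∀ x, G.Adj a x → x ∈ X := by
    intro X
    by_cases h : ∃ c : Fin k → V, Clq G c ∧ Bl G c = X
    · obtain ⟨c, hc, hX⟩ := h
      obtain ⟨i, hi⟩ := hpure c hc
      exact ⟨{v | Pt G c i v}, fun _ => ⟨c, hc, hX, i, rfl, fun a ha x hax => hX ▸ hi a ha x hax⟩⟩
    · exact ⟨∅, fun q => absurd q h⟩
  choose sel hs using hsel
  refine ⟨{v | ∃ c : Fin k → V, Clq G c ∧ v ∈ sel (Bl G c)}, ?_, ?_⟩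
  · rintro u ⟨c, hc, hu⟩ v ⟨d, hd, hv⟩ huv
    obtain ⟨c', hc', ec, i, si, pi⟩ := hs (Bl G c) ⟨c, hc, rfl⟩
    obtain ⟨d', hd', ed, j, sj, pj⟩ := hs (Bl G d) ⟨d, hd, rfl⟩
    have vc := pi u hu v huv
    have ud := pj v hv u huv.symm
    have uc : u ∈ Bl G c := by rw [si] at hu; rw [← ec]; exact ⟨i, hu⟩
    have vd : v ∈ Bl G d := by rw [sj] at hv; rw [← ed]; exact ⟨j, hv⟩
    have e1 := bl_sub hH hk hF hc hd huv uc vc ud vd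
    have e2 := bl_sub hH hk hF hd hc huv ud vd uc vc
    have e : Bl G d = Bl G c := Set.Subset.antisymm e1 e2
    rw [e] at hv
    rw [si] at hu hv
    exact pt_indep hF hc' hu hv huv
  · intro L hL
    obtain ⟨c, hc, ec, i, si, -⟩ := hs (Bl G L) ⟨L, hL, rfl⟩
    obtain ⟨m, hm⟩ := bl_hit hF hc hL (fun m => by rw [ec]; exact ⟨m, pt_self hL m⟩) i
    exact ⟨m, L, hL, by rw [si]; exact hm⟩
end
end PH

namespace PH
universe u
variable {V : Type u} {G : SimpleGraph V}

/-- the component of r in S is complete multipartite -/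
def CM (G : SimpleGraph V) (S : Set V) (r : V) : Prop := ∀ a b c, (Rg G S).Reachable r a →
  (Rg G S).Reachable r b → (Rg G S).Reachable r c → G.Adj a b → G.Adj c a ∨ G.Adj c b

lemma CM.tr {S : Set V} {r s : V} (h : CM G S r) (hrs : (Rg G S).Reachable r s) : CM G S s :=
  fun a b c ha hb hc hab => h a b c (hrs.trans ha) (hrs.trans hb) (hrs.trans hc) hab

lemma olariu (hH : HVNf G) {S : Set V} {u t1 t2 t3 : V} (h1 : t1 ∈ S) (h2 : t2 ∈ S) (h3 : t3 ∈ S)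
    (h12 : G.Adj t1 t2) (h23 : G.Adj t2 t3) (h13 : G.Adj t1 t3)
    (hu : ∀ x, (Rg G S).Reachable t1 x → G.Adj u x) : CM G S t1 := by
  set R := (Rg G S).Reachable t1 with hR
  have step : ∀ x y, R x → (Rg G S).Adj x y → R y := fun x y hx hxy => hx.trans hxy.reachable
  have paw : ∀ p q s d, R p → R q → R s → R d → G.Adj p q → G.Adj p s → G.Adj q s → G.Adj d p →
      G.Adj d q ∨ G.Adj d s := by
    intro p q s d hp hq hs hd pq ps qs dp
    by_contra hn
    push Not at hn
    exact hH u p q s d (hu p hp) (hu q hq) (hu s hs) pq ps qs (hu d hd).symm dp hn.1 hn.2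
  have r1 : R t1 := Reachable.refl _
  have tri : ∀ x, R x → ∃ q s, R q ∧ R s ∧ G.Adj x q ∧ G.Adj x s ∧ G.Adj q s := by
    intro x hx
    refine (reach_const (H := Rg G S)
      (P := fun x => R x ∧ ∃ q s, R q ∧ R s ∧ G.Adj x q ∧ G.Adj x s ∧ G.Adj q s) ?_ hx
      ⟨r1, t2, t3, step _ _ r1 ⟨h12, h1, h2⟩, step _ _ r1 ⟨h13, h1, h3⟩, h12, h13, h23⟩).2
    rintro a b hab ⟨ha, q, s, hq, hs, aq, as, qs⟩
    have hb := step a b ha hab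
    refine ⟨hb, ?_⟩
    rcases paw a q s b ha hq hs hb aq as qs hab.1.symm with k | k
    · exact ⟨a, q, ha, hq, hab.1.symm, k, aq⟩
    · exact ⟨a, s, ha, hs, hab.1.symm, k, as⟩
  have mem : ∀ x, R x → x ∈ S := fun x hx => reach_mem hx h1
  intro a b c ha hb hc hab
  by_contra hn
  push Not at hn
  have spread : ∀ x y, (Rg G S).Adj x y → (R x ∧ ¬ G.Adj c x ∧ ∃ z, R z ∧ G.Adj x z ∧ ¬ G.Adj c z) →
      (R y ∧ ¬ G.Adj c y ∧ ∃ z, R z ∧ G.Adj y z ∧ ¬ G.Adj c z) := by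
    rintro x y hxy ⟨hx, cx, z, hz, xz, cz⟩
    have hy := step _ _ hx hxy
    refine ⟨hy, ?_, x, hx, hxy.1.symm, cx⟩
    intro cy
    -- triangle on x z
    obtain ⟨q0, s0, hq0, hs0, xq0, xs0, qs0⟩ := tri x hx
    have : ∃ q, R q ∧ G.Adj x q ∧ G.Adj z q := by
      rcases paw x q0 s0 z hx hq0 hs0 hz xq0 xs0 qs0 xz.symm with k | k
      · exact ⟨q0, hq0, xq0, k⟩
      · exact ⟨s0, hs0, xs0, k⟩
    obtain ⟨q, hq, xq, zq⟩ := this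
    have cq : ¬ G.Adj c q := by
      intro cq
      rcases paw q x z c hq hx hz hc xq.symm zq.symm xz cq with k | k
      · exact cx k
      · exact cz k
    rcases paw x z q y hx hz hq hy xz xq zq hxy.1.symm with k | k
    · rcases paw y x z c hy hx hz hc hxy.1.symm k xz cy with l | l
      · exact cx l
      · exact cz l
    · rcases paw y x q c hy hx hq hc hxy.1.symm k xq cy with l | l
      · exact cx l
      · exact cq l
  obtain ⟨-, -, z, -, z1, z2⟩ := reach_const (H := Rg G S)
    (P := fun x => (R x ∧ ¬ G.Adj c x ∧ ∃ z, R z ∧ G.Adj x z ∧ ¬ G.Adj c z)) spread (ha.symm.trans hc)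
    ⟨ha, hn.1, b, hb, hab, hn.2⟩
  exact z2 z1

/-- outside neighbours of the i-th part -/
def Bq (G : SimpleGraph V) {k : ℕ} (c : Fin k → V) (i : Fin k) (x : V) : Prop :=
  x ∉ Bl G c ∧ ∃ a, Pt G c i a ∧ G.Adj a x

section
variable {k : ℕ} (hP : P5f G) (hH : HVNf G) (hk : 4 ≤ k)
  (hF : ∀ c : Fin (k+1) → V, ¬ Clq G c) {c : Fin k → V} (hc : Clq G c)

include hH hk hF hc in
lemma bq_uniq {i j : Fin k} {x : V} (hi : Bq G c i x) (hj : Bq G c j x) : i = j := by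
  by_contra hij
  obtain ⟨hx, a, ha, hax⟩ := hi
  obtain ⟨-, b, hb, hbx⟩ := hj
  exact hx (bl_two hH hk hF hc hij ha hb hax.symm hbx.symm)

include hH hk hF hc in
lemma bq_lab (x : V) : ∃ p : Fin k, ∀ l, l ≠ p → ¬ Bq G c l x := by
  by_cases h : ∃ p, Bq G c p x
  · obtain ⟨p, hp⟩ := h
    exact ⟨p, fun l hl hq => hl (bq_uniq hH hk hF hc hq hp)⟩
  · push Not at h
    exact ⟨⟨0, by omega⟩, fun l _ => h l⟩

include hP hH hk hF hc in
lemma F2 {i : Fin k} {x x' y : V} (hx : x ∉ Bl G c) (hx' : x' ∉ Bl G c) (bx : ¬ Bq G c i x)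
    (bx' : ¬ Bq G c i x') (hxx : G.Adj x x') (hy : Bq G c i y) (hyx : G.Adj y x) : G.Adj y x' := by
  by_contra hyx'
  obtain ⟨p, hp⟩ := bq_lab hH hk hF hc x
  obtain ⟨p', hp'⟩ := bq_lab hH hk hF hc x'
  obtain ⟨l, l1, l2, l3⟩ := avoid hk i p p'
  have hyl : ¬ Bq G c l y := fun q => l1 (bq_uniq hH hk hF hc q hy)
  obtain ⟨hyB, a, ha, hay⟩ := hy
  have sl := pt_self hc l
  exact hP x' x y a (c l) hxx.symm hyx.symm hay.symm (pt_comp hH hk hF hc l1.symm ha sl)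
    (fun q => hyx' q.symm) (fun q => bx' ⟨hx', a, ha, q.symm⟩)
    (fun q => hp' l l3 ⟨hx', _, sl, q.symm⟩) (fun q => bx ⟨hx, a, ha, q.symm⟩)
    (fun q => hp l l2 ⟨hx, _, sl, q.symm⟩) (fun q => hyl ⟨hyB, _, sl, q.symm⟩)

/-- outside the block and not attached to part z -/
def Sz (G : SimpleGraph V) {k : ℕ} (c : Fin k → V) (z : Fin k) : Set V :=
  {x | x ∉ Bl G c ∧ ¬ Bq G c z x}

include hP hH hk hF hc in
lemma bz_comp {z : Fin k} {y x x' : V} (hy : Bq G c z y) (hx : x ∈ Sz G c z) (hyx : G.Adj y x)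
    (hr : (Rg G (Sz G c z)).Reachable x x') : G.Adj y x' :=
  reach_const (H := Rg G (Sz G c z)) (P := fun v => G.Adj y v)
    (fun _ _ hab ha => F2 hP hH hk hF hc hab.2.1.1 hab.2.2.1 hab.2.1.2 hab.2.2.2 hab.1 hy ha) hr hyx

include hP hH hk hF hc in
lemma S_dom (hconn : ∀ u v, G.Reachable u v) {z : Fin k} {y r : V} (hy : Bq G c z y)
    (hr : r ∈ Sz G c z) : ∃ u, ∀ x, (Rg G (Sz G c z)).Reachable r x → G.Adj u x := by
  by_cases h : ∃ y' x0, Bq G c z y' ∧ (Rg G (Sz G c z)).Reachable r x0 ∧ G.Adj y' x0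
  · obtain ⟨y', x0, hy', hx0, hyx⟩ := h
    exact ⟨y', fun x hx => bz_comp hP hH hk hF hc hy' (reach_mem hx0 hr) hyx (hx0.symm.trans hx)⟩
  push Not at h
  have hne : ¬ (Rg G (Sz G c z)).Reachable r y := fun q => (reach_mem q hr).2 hy
  obtain ⟨m, b, -, hmb, hm, hb⟩ := boundary (P := fun v => (Rg G (Sz G c z)).Reachable r v)
    (hconn r y) (Reachable.refl _) hne
  have mS := reach_mem hm hr
  have bS : b ∉ Sz G c z := fun q =>
    hb (hm.trans (SimpleGraph.Adj.reachable (G := Rg G (Sz G c z)) ⟨hmb, mS, q⟩))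
  have bB : b ∈ Bl G c := by
    by_contra q
    have : Bq G c z b := by
      by_contra q'
      exact bS ⟨q, q'⟩
    exact h b m this hm hmb.symm
  obtain ⟨i, hi⟩ := bB
  have hiz : i ≠ z := by
    rintro rfl
    exact mS.2 ⟨mS.1, b, hi, hmb.symm⟩
  obtain ⟨hyB, a, ha, hay⟩ := id hy
  refine ⟨b, fun x hx => (reach_const (H := Rg G (Sz G c z))
    (P := fun v => (Rg G (Sz G c z)).Reachable r v ∧ G.Adj b v) ?_ (hm.symm.trans hx)
    ⟨hm, hmb.symm⟩).2⟩
  rintro p q hpq ⟨hp, hbp⟩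
  have hq := hp.trans hpq.reachable
  refine ⟨hq, ?_⟩
  by_contra hbq
  have naz : ∀ v, v ∈ Sz G c z → ¬ G.Adj a v := fun v hv q => hv.2 ⟨hv.1, a, ha, q⟩
  exact hP y a b p q hay.symm (pt_comp hH hk hF hc hiz.symm ha hi) hbp hpq.1
    (fun q => hiz (bq_uniq hH hk hF hc ⟨hyB, b, hi, q.symm⟩ hy)) (h y p hy hp) (h y q hy hq)
    (naz p hpq.2.1) (naz q hpq.2.2) hbq

include hP hH hk hF hc in
lemma impure_case (hconn : ∀ u v, G.Reachable u v) (hB : ∀ i, ∃ y, Bq G c i y) :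
    ∃ I : Set V, (∀ u ∈ I, ∀ v ∈ I, ¬ G.Adj u v) ∧ ∀ L : Fin k → V, Clq G L → ∃ m, L m ∈ I := by
  classical
  let z : Fin k := ⟨0, by omega⟩
  obtain ⟨y, hy⟩ := hB z
  set S := Sz G c z with hS
  let rep : V → V := fun v => ((Rg G S).connectedComponentMk v).out
  have hrep : ∀ v, (Rg G S).Reachable v (rep v) := fun v =>
    (ConnectedComponent.exact (Quot.out_eq ((Rg G S).connectedComponentMk v))).symm
  have hrepeq : ∀ u v, (Rg G S).Reachable u v → rep u = rep v := by
    intro u v h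
    have : (Rg G S).connectedComponentMk u = (Rg G S).connectedComponentMk v :=
      ConnectedComponent.sound h
    simp only [rep, this]
  refine ⟨{v | Pt G c z v ∨ (v ∈ S ∧ CM G S v ∧ ¬ G.Adj v (rep v))}, ?_, ?_⟩
  · rintro u (hu | hu) v (hv | hv) huv
    · exact pt_indep hF hc hu hv huv
    · exact hv.1.2 ⟨hv.1.1, u, hu, huv⟩
    · exact hu.1.2 ⟨hu.1.1, v, hv, huv.symm⟩
    · have hr : (Rg G S).Reachable u v := SimpleGraph.Adj.reachable (G := Rg G S) ⟨huv, hu.1, hv.1⟩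
      have e := hrepeq u v hr
      rcases hu.2.1 u v (rep u) (Reachable.refl _) hr (hrep u) huv with q | q
      · exact hu.2.2 q.symm
      · rw [e] at q; exact hv.2.2 q.symm
  intro L hL
  by_contra hno
  simp only [Set.mem_ofPred_eq, not_exists, not_or] at hno
  have hz : ∀ m, ¬ Pt G c z (L m) := fun m => (hno m).1
  have hJ : ∀ m, L m ∈ S → CM G S (L m) → G.Adj (L m) (rep (L m)) := by
    intro m h1 h2
    by_contra q
    exact (hno m).2 ⟨h1, h2, q⟩
  have radj : ∀ m n, L m ∈ S → L n ∈ S → (Rg G S).Reachable (L m) (L n) := by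
    intro m n hm hn
    by_cases h : m = n
    · rw [h]
    · exact SimpleGraph.Adj.reachable (G := Rg G S) ⟨hL m n h, hm, hn⟩
  by_cases hM : ∃ m, L m ∈ Bl G c
  · obtain ⟨m, hm⟩ := hM
    by_cases hM2 : ∃ n, n ≠ m ∧ L n ∈ Bl G c
    · obtain ⟨n, hnm, hn⟩ := hM2
      have all : ∀ l, L l ∈ Bl G c := by
        intro l
        by_cases h1 : l = m
        · rw [h1]; exact hm
        by_cases h2 : l = n
        · rw [h2]; exact hn
        exact bl_two' hH hk hF hc hm hn (hL _ _ hnm.symm) (hL _ _ h1) (hL _ _ h2)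
      obtain ⟨l, hl⟩ := bl_hit hF hc hL all z
      exact hz l hl
    push Not at hM2
    obtain ⟨i, hi⟩ := hm
    have hiz : i ≠ z := by
      rintro rfl
      exact hz m hi
    have inS : ∀ n, n ≠ m → L n ∈ S := by
      intro n hn
      refine ⟨hM2 n hn, fun q => hiz ?_⟩
      exact bq_uniq hH hk hF hc ⟨hM2 n hn, _, hi, hL _ _ hn.symm⟩ q
    obtain ⟨p, p1, -, -⟩ := avoid hk m m m
    obtain ⟨q, q1, q2, -⟩ := avoid hk m p p
    obtain ⟨s, s1, s2, s3⟩ := avoid hk m p q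
    obtain ⟨u, hu⟩ := S_dom hP hH hk hF hc hconn hy (inS p p1)
    have hCM := olariu hH (inS p p1) (inS q q1) (inS s s1) (hL _ _ q2.symm) (hL _ _ s3.symm)
      (hL _ _ s2.symm) hu
    have hrp : ∀ n, n ≠ m → G.Adj (rep (L p)) (L n) := by
      intro n hn
      have hr := radj p n (inS p p1) (inS n hn)
      rw [hrepeq _ _ hr]
      exact (hJ n (inS n hn) (hCM.tr hr)).symm
    refine no_dom hF (hL.upd (m := m) hrp) (v := u) ?_
    intro n
    by_cases h : n = m
    · subst h; rw [Function.update_self]; exact hu _ (hrep _)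
    · rw [Function.update_of_ne h]; exact hu _ (radj p n (inS p p1) (inS n h))
  push Not at hM
  by_cases hb : ∃ p, Bq G c z (L p)
  swap
  · push Not at hb
    have inS : ∀ n, L n ∈ S := fun n => ⟨hM n, hb n⟩
    obtain ⟨u, hu⟩ := S_dom hP hH hk hF hc hconn hy (inS z)
    exact no_dom hF hL (fun n => hu _ (radj z n (inS z) (inS n)))
  obtain ⟨p, hp⟩ := hb
  by_cases hq : ∃ q, ¬ Bq G c z (L q)
  swap
  · push Not at hq
    obtain ⟨-, a, ha, hap⟩ := id hp
    have : ∃ l, ¬ G.Adj a (L l) := by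
      by_contra h
      push Not at h
      exact no_dom hF hL h
    obtain ⟨l, hl⟩ := this
    have hpl : p ≠ l := by rintro rfl; exact hl hap
    obtain ⟨i, hiz, -, -⟩ := avoid hk z z z
    obtain ⟨y', hy'⟩ := hB i
    obtain ⟨hyB', b, hb, hby⟩ := id hy'
    have nB : ∀ n, ¬ Bq G c i (L n) := fun n q => hiz (bq_uniq hH hk hF hc q (hq n))
    have nb : ∀ n, ¬ G.Adj b (L n) := fun n q => nB n ⟨hM n, b, hb, q⟩
    have hor : ∃ n, G.Adj y' (L n) := by
      by_contra h
      push Not at h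
      exact hP y' b a (L p) (L l) hby.symm (pt_comp hH hk hF hc hiz hb ha) hap (hL _ _ hpl)
        (fun q => hiz (bq_uniq hH hk hF hc ⟨hyB', a, ha, q.symm⟩ hy').symm) (h p) (h l)
        (nb p) (nb l) hl
    obtain ⟨n, hn⟩ := hor
    refine no_dom hF hL (v := y') (fun m => ?_)
    by_cases h : m = n
    · rw [h]; exact hn
    · exact F2 hP hH hk hF hc (hM n) (hM m) (nB n) (nB m) (hL _ _ (Ne.symm h)) hy' hn
  obtain ⟨q, hq⟩ := hq
  have qS : L q ∈ S := ⟨hM q, hq⟩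
  have bcomp : ∀ n, Bq G c z (L n) → ∀ x, (Rg G S).Reachable (L q) x → G.Adj (L n) x := by
    intro n hn x hx
    have hnq : n ≠ q := by rintro rfl; exact hq hn
    exact bz_comp hP hH hk hF hc hn qS (hL _ _ hnq) hx
  have hCM : CM G S (L q) := by
    by_cases h2 : ∃ n, n ≠ p ∧ Bq G c z (L n)
    · obtain ⟨n, hnp, hn⟩ := h2
      intro a b d ha hb hd hab
      by_contra h
      push Not at h
      exact hH (L p) (L n) a b d (hL _ _ hnp.symm) (bcomp p hp a ha) (bcomp p hp b hb)
        (bcomp n hn a ha) (bcomp n hn b hb) hab (bcomp p hp d hd).symm (bcomp n hn d hd).symm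
        h.1 h.2
    · push Not at h2
      have hpq : q ≠ p := by rintro rfl; exact hq hp
      obtain ⟨s, s1, s2, -⟩ := avoid hk p q q
      obtain ⟨t, t1, t2, t3⟩ := avoid hk p q s
      exact olariu hH qS ⟨hM s, h2 s s1⟩ ⟨hM t, h2 t t1⟩ (hL _ _ s2.symm) (hL _ _ t3.symm)
        (hL _ _ t2.symm) (bcomp p hp)
  refine no_dom hF hL (v := rep (L q)) (fun n => ?_)
  by_cases hn : Bq G c z (L n)
  · exact (bcomp n hn _ (hrep _)).symm
  · have nS : L n ∈ S := ⟨hM n, hn⟩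
    have hr := radj q n qS nS
    rw [hrepeq _ _ hr]
    exact (hJ n nS (hCM.tr hr)).symm
end

lemma partII {k : ℕ} (hP : P5f G) (hH : HVNf G) (hk : 4 ≤ k) (hF : ∀ c : Fin (k+1) → V, ¬ Clq G c)
    (hconn : ∀ u v, G.Reachable u v) :
    ∃ I : Set V, (∀ u ∈ I, ∀ v ∈ I, ¬ G.Adj u v) ∧ ∀ L : Fin k → V, Clq G L → ∃ m, L m ∈ I := by
  by_cases hpure : ∀ c : Fin k → V, Clq G c → ∃ i, ∀ a, Pt G c i a → ∀ x, G.Adj a x → x ∈ Bl G c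
  · exact pure_case hH hk hF hpure
  · push Not at hpure
    obtain ⟨c, hc, h⟩ := hpure
    refine impure_case hP hH hk hF hc hconn ?_
    intro i
    obtain ⟨a, ha, x, hax, hx⟩ := h i
    exact ⟨x, hx, a, ha, hax⟩

/-- no sequence of n pairwise adjacent vertices -/
def Kf (G : SimpleGraph V) (n : ℕ) : Prop := ∀ c : Fin n → V, ¬ Clq G c

lemma comp_red {n : ℕ} (h : ∀ C : G.ConnectedComponent, C.toSimpleGraph.Colorable n) :
    G.Colorable n := colorable_iff_forall_connectedComponent.2 h

lemma hered (W : Set V) :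
    (P5f G → P5f (G.induce W)) ∧ (HVNf G → HVNf (G.induce W)) ∧
    ∀ n, Kf G n → Kf (G.induce W) n := by
  refine ⟨fun h a b c d e => h a b c d e, fun h a b c d e => h a b c d e, fun n h c hc => ?_⟩
  exact h (fun i => (c i : V)) (fun i j hij => hc i j hij)

lemma main : ∀ (k : ℕ) {V : Type u} (G : SimpleGraph V), P5f G → HVNf G → Kf G (k+4) →
    G.Colorable (k+6) := by
  intro k
  induction k with
  | zero =>
    intro V G hP hH hK
    refine comp_red (fun C => ?_)
    obtain ⟨h1, h2, h3⟩ := hered (G := G) C.supp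
    refine partI (h1 hP) ?_ (fun u v => C.connected_toSimpleGraph u v)
    intro a b c d ab ac ad bc bd cd
    refine h3 _ hK ![a, b, c, d] ?_
    intro i j hij
    fin_cases i <;> fin_cases j <;> first | exact absurd rfl hij | skip
    exacts [ab, ac, ad, ab.symm, bc, bd, ac.symm, bc.symm, cd, ad.symm, bd.symm, cd.symm]
  | succ k ih =>
    intro V G hP hH hK
    refine comp_red (fun C => ?_)
    obtain ⟨h1, h2, h3⟩ := hered (G := G) C.supp
    obtain ⟨I, hI, hit⟩ := partII (k := k + 4) (h1 hP) (h2 hH) (by omega) (h3 _ hK)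
      (fun u v => C.connected_toSimpleGraph u v)
    obtain ⟨i1, i2, -⟩ := hered (G := C.toSimpleGraph) Iᶜ
    have hK' : Kf (C.toSimpleGraph.induce Iᶜ) (k+4) := by
      intro c hc
      obtain ⟨m, hm⟩ := hit (fun i => (c i : C)) (fun i j hij => hc i j hij)
      exact (c m).2 hm
    obtain ⟨col⟩ := ih (C.toSimpleGraph.induce Iᶜ) (i1 (h1 hP)) (i2 (h2 hH)) hK'
    classical
    refine colorable_of_nat (fun v => if h : v ∈ I then k + 6 else (col ⟨v, h⟩ : ℕ)) ?_ ?_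
    · intro v
      split_ifs with h
      · omega
      · have := (col ⟨v, h⟩).2; omega
    · intro u v huv
      split_ifs with a b b
      · exact absurd huv (hI u a v b)
      · have := (col ⟨v, b⟩).2; omega
      · have := (col ⟨u, a⟩).2; omega
      · intro e
        exact col.valid (v := ⟨u, a⟩) (w := ⟨v, b⟩) huv (Fin.ext e)
end PH

namespace PH
universe u
variable {V : Type u} {G : SimpleGraph V}

lemma emb_of {n : ℕ} {H : SimpleGraph (Fin n)} (f : Fin n → V)
    (hf : ∀ i j, H.Adj i j ↔ G.Adj (f i) (f j))
    (hH : ∀ i j, (∀ l, H.Adj i l ↔ H.Adj j l) → i = j) : ContainsInduced G H := by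
  refine ⟨⟨f, fun i j hij => hH i j (fun l => ?_)⟩, hf⟩
  rw [hf, hf, hij]

lemma p5f_of (h : InducedFree G (pathGraph 5)) : P5f G := by
  intro a b c d e ab bc cd de ac ad ae bd be ce
  apply h
  refine emb_of ![a, b, c, d, e] ?_ ?_
  · have h1 := ab.symm; have h2 := bc.symm; have h3 := cd.symm; have h4 := de.symm
    have g1 : ¬ G.Adj c a := fun q => ac q.symm
    have g2 : ¬ G.Adj d a := fun q => ad q.symm
    have g3 : ¬ G.Adj e a := fun q => ae q.symm
    have g4 : ¬ G.Adj d b := fun q => bd q.symm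
    have g5 : ¬ G.Adj e b := fun q => be q.symm
    have g6 : ¬ G.Adj e c := fun q => ce q.symm
    intro i j
    rw [pathGraph_adj]
    fin_cases i <;> fin_cases j <;> simp [*]
  · simp only [pathGraph_adj]
    decide +kernel

lemma hvnf_of (h : InducedFree G hvnGraph) : HVNf G := by
  intro a b c d e ab ac ad bc bd cd ea eb ec ed
  apply h
  refine emb_of ![a, b, c, d, e] ?_ ?_
  · have h1 := ab.symm; have h2 := ac.symm; have h3 := ad.symm; have h4 := bc.symm
    have h5 := bd.symm; have h6 := cd.symm; have h7 := ea.symm; have h8 := eb.symm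
    have g1 : ¬ G.Adj c e := fun q => ec q.symm
    have g2 : ¬ G.Adj d e := fun q => ed q.symm
    intro i j
    fin_cases i <;> fin_cases j <;> simp [hvnGraph, *]
  · simp only [hvnGraph, fromEdgeSet_adj]
    simp only [Set.mem_insert_iff, Set.mem_singleton_iff]
    decide +kernel

lemma kf_cliqueNum [Fintype V] : Kf G (G.cliqueNum + 1) := by
  classical
  intro c hc
  have hinj : Function.Injective c := by
    intro i j hij
    by_contra hne
    have := hc i j hne
    rw [hij] at this
    exact G.loopless.irrefl _ this
  have h : G.IsClique (Finset.univ.image c : Finset V) := by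
    intro u hu v hv huv
    simp only [Finset.coe_image, Finset.coe_univ, Set.image_univ, Set.mem_range] at hu hv
    obtain ⟨i, rfl⟩ := hu
    obtain ⟨j, rfl⟩ := hv
    exact hc i j (fun e => huv (by rw [e]))
  have := h.card_le_cliqueNum
  rw [Finset.card_image_of_injective _ hinj, Finset.card_univ, Fintype.card_fin] at this
  omega

lemma three_le [Fintype V] (hT : ContainsInduced G t5WheelGraph) : 3 ≤ G.cliqueNum := by
  classical
  obtain ⟨f, hf⟩ := hT
  have h01 : G.Adj (f 0) (f 1) := (hf 0 1).1 (by simp [t5WheelGraph])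
  have h05 : G.Adj (f 5) (f 0) := (hf 5 0).1 (by simp [t5WheelGraph])
  have h15 : G.Adj (f 5) (f 1) := (hf 5 1).1 (by simp [t5WheelGraph])
  have h : G.IsNClique 3 {f 5, f 0, f 1} := is3Clique_triple_iff.2 ⟨h05, h15, h01⟩
  have := h.isClique.card_le_cliqueNum
  rwa [h.card_eq] at this
end PH

/-- A (P₅, HVN)-free graph containing an induced T-5-wheel satisfies χ(G) ≤ ω(G) + 3. -/
theorem chi_le_omega_add_three_of_t5wheel {V : Type*} [Fintype V] (G : SimpleGraph V)
    (hP5 : InducedFree G (pathGraph 5)) (hHVN : InducedFree G hvnGraph)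
    (hT5 : ContainsInduced G t5WheelGraph) :
    G.chromaticNumber ≤ (G.cliqueNum + 3 : ℕ) := by
  have h3 := PH.three_le hT5
  have hK : PH.Kf G ((G.cliqueNum - 3) + 4) := by
    have e : (G.cliqueNum - 3) + 4 = G.cliqueNum + 1 := by omega
    rw [e]
    exact PH.kf_cliqueNum
  have hcol := PH.main (G.cliqueNum - 3) G (PH.p5f_of hP5) (PH.hvnf_of hHVN) hK
  have e : (G.cliqueNum - 3) + 6 = G.cliqueNum + 3 := by omega
  rw [e] at hcol
  exact hcol.chromaticNumber_le
end
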